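/- Let p, r : [0,1] → ℝ be continuous with p(x) > 0 and r(x) > 0 for all x ∈ [0,1], let c < 0, and let n ≥ 1. Suppose λ < 0 is an eigenvalue of the problem (E_T) with boundary conditions (BC1), suppose the set of eigenvalues μ of this problem with λ < μ < 0 has exactly n − 1 elements, and let y be a nontrivial classical solution at λ. Then the set {x ∈ (0,1) : y(x) = 0} has exactly n − 1 elements, and y'(a) ≠ 0 for every a ∈ (0,1) with y(a) = 0. -/

import Mathlib

open Set

/-- Derivative within the interval `[0,1]`. -/
noncomputable def Dv (y : ℝ → ℝ) : ℝ → ℝ := derivWithin y (Set.Icc 0 1)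

/-- `y` is not identically zero on `[0,1]`. -/
def Nontriv (y : ℝ → ℝ) : Prop := ∃ x ∈ Set.Icc (0:ℝ) 1, y x ≠ 0

/-- `y` is a classical solution of `(p y'')'' - lam * (-y'' + c r y) = 0` on `[0,1]`. -/
def SolT (p r : ℝ → ℝ) (c lam : ℝ) (y : ℝ → ℝ) : Prop :=
  ContDiffOn ℝ 2 y (Set.Icc 0 1) ∧
  ContDiffOn ℝ 2 (fun x => p x * Dv (Dv y) x) (Set.Icc 0 1) ∧
  ∀ x ∈ Set.Icc (0:ℝ) 1,
    Dv (Dv (fun t => p t * Dv (Dv y) t)) x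
      - lam * (-(Dv (Dv y) x) + c * r x * y x) = 0

/-- Clamped boundary conditions `y(0) = y'(0) = y(1) = y'(1) = 0`. -/
def BC1 (y : ℝ → ℝ) : Prop := y 0 = 0 ∧ Dv y 0 = 0 ∧ y 1 = 0 ∧ Dv y 1 = 0

/-- Boundary conditions `y(0) = y'(0) = y'(1) = 0`, `(p y'')'(1) + lam * alpha * y(1) = 0`. -/
def BC2 (p : ℝ → ℝ) (lam alpha : ℝ) (y : ℝ → ℝ) : Prop :=
  y 0 = 0 ∧ Dv y 0 = 0 ∧ Dv y 1 = 0 ∧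
  Dv (fun t => p t * Dv (Dv y) t) 1 + lam * alpha * y 1 = 0

/-- Linear dependence of two functions on `[0,1]`. -/
def LinDep (y₁ y₂ : ℝ → ℝ) : Prop :=
  ∃ a b : ℝ, (a ≠ 0 ∨ b ≠ 0) ∧ ∀ x ∈ Set.Icc (0:ℝ) 1, a * y₁ x + b * y₂ x = 0

/-- `lam` is an eigenvalue of the problem (E_T), (BC1). -/
def EigT1 (p r : ℝ → ℝ) (c lam : ℝ) : Prop :=
  ∃ y : ℝ → ℝ, SolT p r c lam y ∧ Nontriv y ∧ BC1 y

open Filter Topology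

/-! ## The first-order system -/

structure Sys (q r : ℝ → ℝ) (μ : ℝ) (y u w z : ℝ → ℝ) : Prop where
  dy : ∀ x ∈ Icc (0:ℝ) 1, HasDerivWithinAt y (u x) (Icc 0 1) x
  du : ∀ x ∈ Icc (0:ℝ) 1, HasDerivWithinAt u (q x * w x) (Icc 0 1) x
  dw : ∀ x ∈ Icc (0:ℝ) 1, HasDerivWithinAt w (z x) (Icc 0 1) x
  dz : ∀ x ∈ Icc (0:ℝ) 1, HasDerivWithinAt z (μ * (q x * w x + r x * y x)) (Icc 0 1) x

structure Coef (q r : ℝ → ℝ) : Prop where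
  qc : ContinuousOn q (Icc 0 1)
  rc : ContinuousOn r (Icc 0 1)
  qp : ∀ x ∈ Icc (0:ℝ) 1, 0 < q x
  rp : ∀ x ∈ Icc (0:ℝ) 1, 0 < r x

lemma contOn_of_dv {f g : ℝ → ℝ}
    (h : ∀ x ∈ Icc (0:ℝ) 1, HasDerivWithinAt f (g x) (Icc 0 1) x) : ContinuousOn f (Icc 0 1) :=
  fun x hx => (h x hx).continuousWithinAt

lemma hasDerivAt_of_dv {f g : ℝ → ℝ}
    (h : ∀ x ∈ Icc (0:ℝ) 1, HasDerivWithinAt f (g x) (Icc 0 1) x) {x : ℝ} (hx : x ∈ Ioo (0:ℝ) 1) :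
    HasDerivAt f (g x) x :=
  (h x (Ioo_subset_Icc_self hx)).hasDerivAt (Icc_mem_nhds hx.1 hx.2)

lemma mono_of_dv {f g : ℝ → ℝ} {a b : ℝ} (ha : 0 ≤ a) (hb : b ≤ 1)
    (h : ∀ x ∈ Icc (0:ℝ) 1, HasDerivWithinAt f (g x) (Icc 0 1) x)
    (hg : ∀ x ∈ Ioo a b, 0 ≤ g x) : MonotoneOn f (Icc a b) := by
  have hsub : Icc a b ⊆ Icc (0:ℝ) 1 := Icc_subset_Icc ha hb
  refine monotoneOn_of_hasDerivWithinAt_nonneg (f' := g) (convex_Icc a b)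
    ((contOn_of_dv h).mono hsub) ?_ ?_
  · intro x hx
    exact (h x (hsub (interior_subset hx))).mono (interior_subset.trans hsub)
  · intro x hx
    rw [interior_Icc] at hx
    exact hg x hx

lemma smono_of_dv {f g : ℝ → ℝ} {a b : ℝ} (ha : 0 ≤ a) (hb : b ≤ 1)
    (h : ∀ x ∈ Icc (0:ℝ) 1, HasDerivWithinAt f (g x) (Icc 0 1) x)
    (hg : ∀ x ∈ Ioo a b, 0 < g x) : StrictMonoOn f (Icc a b) := by
  have hsub : Icc a b ⊆ Icc (0:ℝ) 1 := Icc_subset_Icc ha hb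
  refine strictMonoOn_of_hasDerivWithinAt_pos (f' := g) (convex_Icc a b)
    ((contOn_of_dv h).mono hsub) ?_ ?_
  · intro x hx
    exact (h x (hsub (interior_subset hx))).mono (interior_subset.trans hsub)
  · intro x hx
    rw [interior_Icc] at hx
    exact hg x hx

lemma pos_of_dv {f g : ℝ → ℝ} {a b : ℝ} (ha : 0 ≤ a) (hb : b ≤ 1)
    (h : ∀ x ∈ Icc (0:ℝ) 1, HasDerivWithinAt f (g x) (Icc 0 1) x)
    (hg : ∀ x ∈ Ioo a b, 0 < g x) (h0 : 0 ≤ f a) : ∀ x ∈ Ioc a b, 0 < f x := by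
  intro x hx
  have := smono_of_dv ha hb h hg (left_mem_Icc.2 (hx.1.le.trans hx.2)) ⟨hx.1.le, hx.2⟩ hx.1
  linarith

lemma hasDerivAt_minsq (x : ℝ) : HasDerivAt (fun t : ℝ => (min t 0) ^ 2) (2 * min x 0) x := by
  rcases lt_trichotomy x 0 with hx | hx | hx
  · have h1 : HasDerivAt (fun t : ℝ => t ^ 2) (2 * min x 0) x := by
      have := hasDerivAt_pow 2 x
      rw [min_eq_left hx.le]; simpa using this
    refine h1.congr_of_eventuallyEq ?_
    filter_upwards [Iio_mem_nhds hx] with t ht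
    rw [min_eq_left (le_of_lt ht)]
  · subst hx
    simp only [min_self, mul_zero]
    rw [hasDerivAt_iff_isLittleO]
    simp only [min_self, sub_zero, smul_zero, ne_eq, OfNat.ofNat_ne_zero, not_false_eq_true, zero_pow]
    have h2 : (fun t : ℝ => t ^ 2) =o[𝓝 0] (fun t : ℝ => t) := by
      have := Asymptotics.isLittleO_pow_pow (𝕜 := ℝ) (m := 1) (n := 2) (by norm_num)
      simpa using this
    refine Asymptotics.IsBigO.trans_isLittleO ?_ h2
    refine Asymptotics.IsBigO.of_bound 1 (Eventually.of_forall fun t => ?_)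
    simp only [norm_pow, Real.norm_eq_abs, sq_abs, one_mul]
    rcases le_total t 0 with h | h
    · simp [min_eq_left h]
    · simp [min_eq_right h]; positivity
  · rw [min_eq_right hx.le]
    have h1 : HasDerivAt (fun _ : ℝ => (0:ℝ)) (2 * 0) x := by simpa using hasDerivAt_const x (0:ℝ)
    refine h1.congr_of_eventuallyEq ?_
    filter_upwards [Ioi_mem_nhds hx] with t ht
    rw [min_eq_right (le_of_lt ht)]; simp

lemma Coef.bdd {q r : ℝ → ℝ} (hC : Coef q r) : ∃ B, 0 < B ∧ ∀ x ∈ Icc (0:ℝ) 1, q x ≤ B ∧ r x ≤ B := by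
  obtain ⟨B1, h1⟩ := (isCompact_Icc.image_of_continuousOn hC.qc).bddAbove
  obtain ⟨B2, h2⟩ := (isCompact_Icc.image_of_continuousOn hC.rc).bddAbove
  refine ⟨max 1 (max B1 B2), by positivity, fun x hx => ⟨?_, ?_⟩⟩
  · exact (h1 (mem_image_of_mem _ hx)).trans (by simp)
  · exact (h2 (mem_image_of_mem _ hx)).trans (by simp)

lemma minsq_ineq {B μ q r y u w z : ℝ} (hq : 0 < q) (hr : 0 < r) (hqB : q ≤ B) (hrB : r ≤ B)
    (hμ : 0 ≤ μ) :
    2 * min y 0 * u + 2 * min u 0 * (q * w) + 2 * min w 0 * z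
      + 2 * min z 0 * (μ * (q * w + r * y))
    ≤ (2 + 2 * B + 4 * μ * B) * ((min y 0)^2 + (min u 0)^2 + (min w 0)^2 + (min z 0)^2) := by
  have ky := min_le_left y 0
  have ku := min_le_left u 0
  have kw := min_le_left w 0
  have kz := min_le_left z 0
  have ly := min_le_right y 0
  have lu := min_le_right u 0
  have lw := min_le_right w 0
  have lz := min_le_right z 0
  generalize min y 0 = Y at *
  generalize min u 0 = U at *
  generalize min w 0 = W at *
  generalize min z 0 = Z at *
  have hB : 0 < B := hq.trans_le hqB
  have e1 : 2 * Y * u ≤ Y^2 + U^2 := by nlinarith [sq_nonneg (Y - U)]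
  have e3 : 2 * W * z ≤ W^2 + Z^2 := by nlinarith [sq_nonneg (W - Z)]
  have e2 : 2 * U * (q * w) ≤ B * (U^2 + W^2) := by
    have h1 : 2 * U * w ≤ U^2 + W^2 := by nlinarith [sq_nonneg (U - W)]
    calc 2 * U * (q * w) = q * (2 * U * w) := by ring
      _ ≤ q * (U^2 + W^2) := by gcongr
      _ ≤ B * (U^2 + W^2) := by gcongr
  have e4 : 2 * Z * (q * w) ≤ B * (Z^2 + W^2) := by
    have h1 : 2 * Z * w ≤ Z^2 + W^2 := by nlinarith [sq_nonneg (Z - W)]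
    calc 2 * Z * (q * w) = q * (2 * Z * w) := by ring
      _ ≤ q * (Z^2 + W^2) := by gcongr
      _ ≤ B * (Z^2 + W^2) := by gcongr
  have e5 : 2 * Z * (r * y) ≤ B * (Z^2 + Y^2) := by
    have h1 : 2 * Z * y ≤ Z^2 + Y^2 := by nlinarith [sq_nonneg (Z - Y)]
    calc 2 * Z * (r * y) = r * (2 * Z * y) := by ring
      _ ≤ r * (Z^2 + Y^2) := by gcongr
      _ ≤ B * (Z^2 + Y^2) := by gcongr
  have e6 : 2 * Z * (μ * (q * w + r * y)) ≤ μ * B * (2 * Z^2 + W^2 + Y^2) := by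
    calc 2 * Z * (μ * (q * w + r * y)) = μ * (2 * Z * (q * w) + 2 * Z * (r * y)) := by ring
      _ ≤ μ * (B * (Z^2 + W^2) + B * (Z^2 + Y^2)) := by gcongr
      _ = _ := by ring
  have hμB : 0 ≤ μ * B := by positivity
  have p1 : 0 ≤ B * (2 * Y^2 + U^2 + W^2 + 2*Z^2) := by positivity
  have p2 : 0 ≤ μ * B * (3 * Y^2 + 4 * U^2 + 3 * W^2 + 2 * Z^2) := by positivity
  nlinarith [sq_nonneg Y, sq_nonneg U, sq_nonneg W, sq_nonneg Z]

lemma Sys.nonneg {q r : ℝ → ℝ} (hC : Coef q r) {μ : ℝ} (hμ : 0 ≤ μ) {y u w z : ℝ → ℝ}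
    (S : Sys q r μ y u w z) {a : ℝ} (ha : a ∈ Icc (0:ℝ) 1)
    (h1 : 0 ≤ y a) (h2 : 0 ≤ u a) (h3 : 0 ≤ w a) (h4 : 0 ≤ z a) :
    ∀ x ∈ Icc a 1, 0 ≤ y x ∧ 0 ≤ u x ∧ 0 ≤ w x ∧ 0 ≤ z x := by
  obtain ⟨B, hB, hb⟩ := hC.bdd
  set C := 2 + 2 * B + 4 * μ * B with hCd
  set V : ℝ → ℝ := fun x => (min (y x) 0)^2 + (min (u x) 0)^2 + (min (w x) 0)^2 + (min (z x) 0)^2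
    with hV
  have dV : ∀ x ∈ Icc (0:ℝ) 1, HasDerivWithinAt (fun x => -(Real.exp (-(C * x)) * V x))
      (-(Real.exp (-(C*x)) * (-C) * V x + Real.exp (-(C*x)) *
        (2 * min (y x) 0 * u x + 2 * min (u x) 0 * (q x * w x) + 2 * min (w x) 0 * z x
      + 2 * min (z x) 0 * (μ * (q x * w x + r x * y x))))) (Icc 0 1) x := by
    intro x hx
    have g1 := (hasDerivAt_minsq (y x)).comp_hasDerivWithinAt x (S.dy x hx)
    have g2 := (hasDerivAt_minsq (u x)).comp_hasDerivWithinAt x (S.du x hx)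
    have g3 := (hasDerivAt_minsq (w x)).comp_hasDerivWithinAt x (S.dw x hx)
    have g4 := (hasDerivAt_minsq (z x)).comp_hasDerivWithinAt x (S.dz x hx)
    have g5 : HasDerivWithinAt (fun x : ℝ => Real.exp (-(C*x))) (Real.exp (-(C*x)) * (-C)) (Icc 0 1) x := by
      have : HasDerivAt (fun x : ℝ => -(C*x)) (-C) x := by
        exact ((hasDerivAt_id x).const_mul C).neg.congr_deriv (by simp)
      exact this.exp.hasDerivWithinAt
    exact (g5.mul (((g1.add g2).add g3).add g4)).neg
  have hm := mono_of_dv ha.1 le_rfl dV (by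
    intro x hx
    have hx' : x ∈ Icc (0:ℝ) 1 := ⟨ha.1.trans hx.1.le, hx.2.le⟩
    have := minsq_ineq (y := y x) (u := u x) (w := w x) (z := z x) (hC.qp x hx') (hC.rp x hx')
      (hb x hx').1 (hb x hx').2 hμ
    have he := Real.exp_pos (-(C*x))
    have h0 : Real.exp (-(C*x)) * (C * V x - (2 * min (y x) 0 * u x + 2 * min (u x) 0 * (q x * w x) + 2 * min (w x) 0 * z x
      + 2 * min (z x) 0 * (μ * (q x * w x + r x * y x)))) ≥ 0 := by
      apply mul_nonneg he.le
      simp only [hV, hCd]; linarith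
    linarith)
  intro x hx
  have hh := hm ⟨le_rfl, ha.2⟩ hx hx.1
  have hVa : V a = 0 := by simp [hV, min_eq_right h1, min_eq_right h2, min_eq_right h3, min_eq_right h4]
  simp only [hVa, mul_zero, neg_zero] at hh
  have hVx : V x ≤ 0 := by
    by_contra hcon
    push Not at hcon
    have := mul_pos (Real.exp_pos (-(C*x))) hcon
    linarith
  simp only [hV] at hVx
  have k1 := sq_nonneg (min (y x) 0)
  have k2 := sq_nonneg (min (u x) 0)
  have k3 := sq_nonneg (min (w x) 0)
  have k4 := sq_nonneg (min (z x) 0)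
  refine ⟨?_, ?_, ?_, ?_⟩
  · have : min (y x) 0 = 0 := by
      have : (min (y x) 0)^2 = 0 := by linarith
      simpa using this
    exact min_eq_right_iff.1 this
  · have : min (u x) 0 = 0 := by
      have : (min (u x) 0)^2 = 0 := by linarith
      simpa using this
    exact min_eq_right_iff.1 this
  · have : min (w x) 0 = 0 := by
      have : (min (w x) 0)^2 = 0 := by linarith
      simpa using this
    exact min_eq_right_iff.1 this
  · have : min (z x) 0 = 0 := by
      have : (min (z x) 0)^2 = 0 := by linarith
      simpa using this
    exact min_eq_right_iff.1 this

lemma Sys.lin {q r : ℝ → ℝ} {μ : ℝ} {y u w z y' u' w' z' : ℝ → ℝ}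
    (S : Sys q r μ y u w z) (S' : Sys q r μ y' u' w' z') (a b : ℝ) :
    Sys q r μ (fun x => a * y x + b * y' x) (fun x => a * u x + b * u' x)
      (fun x => a * w x + b * w' x) (fun x => a * z x + b * z' x) where
  dy x hx := ((S.dy x hx).const_mul a).add ((S'.dy x hx).const_mul b)
  du x hx := (((S.du x hx).const_mul a).add ((S'.du x hx).const_mul b)).congr_deriv (by ring)
  dw x hx := ((S.dw x hx).const_mul a).add ((S'.dw x hx).const_mul b)
  dz x hx := (((S.dz x hx).const_mul a).add ((S'.dz x hx).const_mul b)).congr_deriv (by ring)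

lemma Sys.neg {q r : ℝ → ℝ} {μ : ℝ} {y u w z : ℝ → ℝ} (S : Sys q r μ y u w z) :
    Sys q r μ (fun x => - y x) (fun x => - u x) (fun x => - w x) (fun x => - z x) where
  dy x hx := (S.dy x hx).neg
  du x hx := (S.du x hx).neg.congr_deriv (by ring)
  dw x hx := (S.dw x hx).neg
  dz x hx := (S.dz x hx).neg.congr_deriv (by ring)

lemma refl_mem {x : ℝ} (hx : x ∈ Icc (0:ℝ) 1) : 1 - x ∈ Icc (0:ℝ) 1 := ⟨by linarith [hx.2], by linarith [hx.1]⟩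

lemma refl_dv {f g : ℝ → ℝ}
    (h : ∀ x ∈ Icc (0:ℝ) 1, HasDerivWithinAt f (g x) (Icc 0 1) x) :
    ∀ x ∈ Icc (0:ℝ) 1, HasDerivWithinAt (fun t => f (1 - t)) (- g (1 - x)) (Icc 0 1) x := by
  intro x hx
  have h1 : HasDerivWithinAt (fun t : ℝ => 1 - t) (-1) (Icc 0 1) x := by
    simpa using ((hasDerivAt_id x).const_sub 1).hasDerivWithinAt
  exact ((h (1 - x) (refl_mem hx)).comp x h1 (fun t ht => refl_mem ht)).congr_deriv (by ring)

lemma Coef.refl {q r : ℝ → ℝ} (hC : Coef q r) : Coef (fun x => q (1 - x)) (fun x => r (1 - x)) where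
  qc := hC.qc.comp (by fun_prop) (fun _ h => refl_mem h)
  rc := hC.rc.comp (by fun_prop) (fun _ h => refl_mem h)
  qp x hx := hC.qp _ (refl_mem hx)
  rp x hx := hC.rp _ (refl_mem hx)

lemma Sys.refl {q r : ℝ → ℝ} {μ : ℝ} {y u w z : ℝ → ℝ} (S : Sys q r μ y u w z) :
    Sys (fun x => q (1 - x)) (fun x => r (1 - x)) μ
      (fun x => y (1 - x)) (fun x => - u (1 - x)) (fun x => w (1 - x)) (fun x => - z (1 - x)) where
  dy := refl_dv S.dy
  du x hx := ((refl_dv S.du) x hx).neg.congr_deriv (by ring)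
  dw := refl_dv S.dw
  dz x hx := ((refl_dv S.dz) x hx).neg.congr_deriv (by ring)

lemma Sys.zero_right {q r : ℝ → ℝ} (hC : Coef q r) {μ : ℝ} (hμ : 0 ≤ μ) {y u w z : ℝ → ℝ}
    (S : Sys q r μ y u w z) {a : ℝ} (ha : a ∈ Icc (0:ℝ) 1)
    (h1 : y a = 0) (h2 : u a = 0) (h3 : w a = 0) (h4 : z a = 0) :
    ∀ x ∈ Icc a 1, y x = 0 ∧ u x = 0 ∧ w x = 0 ∧ z x = 0 := by
  intro x hx
  have A := S.nonneg hC hμ ha h1.ge h2.ge h3.ge h4.ge x hx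
  have B := S.neg.nonneg hC hμ ha (by simp [h1]) (by simp [h2]) (by simp [h3]) (by simp [h4]) x hx
  refine ⟨?_, ?_, ?_, ?_⟩ <;> linarith [A.1, A.2.1, A.2.2.1, A.2.2.2, B.1, B.2.1, B.2.2.1, B.2.2.2]

lemma Sys.zero {q r : ℝ → ℝ} (hC : Coef q r) {μ : ℝ} (hμ : 0 ≤ μ) {y u w z : ℝ → ℝ}
    (S : Sys q r μ y u w z) {a : ℝ} (ha : a ∈ Icc (0:ℝ) 1)
    (h1 : y a = 0) (h2 : u a = 0) (h3 : w a = 0) (h4 : z a = 0) :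
    ∀ x ∈ Icc (0:ℝ) 1, y x = 0 ∧ u x = 0 ∧ w x = 0 ∧ z x = 0 := by
  intro x hx
  rcases le_total a x with h | h
  · exact S.zero_right hC hμ ha h1 h2 h3 h4 x ⟨h, hx.2⟩
  · have := S.refl.zero_right hC.refl hμ (refl_mem ha) (by simpa using h1) (by simpa using h2)
      (by simpa using h3) (by simpa using h4) (1 - x) ⟨by linarith, by linarith [hx.1]⟩
    simpa using this

/-- Positivity to the right of a double zero. -/
lemma Sys.pos_right {q r : ℝ → ℝ} (hC : Coef q r) {μ : ℝ} (hμ : 0 ≤ μ) {y u w z : ℝ → ℝ}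
    (S : Sys q r μ y u w z) {a : ℝ} (ha : a ∈ Ico (0:ℝ) 1)
    (h1 : y a = 0) (h2 : u a = 0) (h3 : 0 ≤ w a) (h4 : 0 ≤ z a) (h5 : w a ≠ 0 ∨ z a ≠ 0) :
    0 < y 1 := by
  have ha' : a ∈ Icc (0:ℝ) 1 := ⟨ha.1, ha.2.le⟩
  have A := S.nonneg hC hμ ha' h1.ge h2.ge h3 h4
  have hsub : ∀ x ∈ Ioo a 1, x ∈ Icc (0:ℝ) 1 := fun x hx => ⟨ha.1.trans hx.1.le, hx.2.le⟩
  have hz : MonotoneOn z (Icc a 1) := mono_of_dv ha.1 le_rfl S.dz (fun x hx => by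
    have h := A x ⟨hx.1.le, hx.2.le⟩
    have := (hC.qp x (hsub x hx)).le
    have := (hC.rp x (hsub x hx)).le
    have := h.1
    have := h.2.2.1
    positivity)
  have hw : MonotoneOn w (Icc a 1) := mono_of_dv ha.1 le_rfl S.dw (fun x hx =>
    (A x ⟨hx.1.le, hx.2.le⟩).2.2.2)
  have hwp : ∀ x ∈ Ioo a 1, 0 < w x := by
    rcases h5 with h5 | h5
    · intro x hx
      have := hw (left_mem_Icc.2 ha.2.le) ⟨hx.1.le, hx.2.le⟩ hx.1.le
      exact (lt_of_le_of_ne h3 h5.symm).trans_le this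
    · intro x hx
      refine pos_of_dv ha.1 le_rfl S.dw ?_ h3 x ⟨hx.1, hx.2.le⟩
      intro t ht
      have := hz (left_mem_Icc.2 ha.2.le) ⟨ht.1.le, ht.2.le⟩ ht.1.le
      exact (lt_of_le_of_ne h4 h5.symm).trans_le this
  have hup : ∀ x ∈ Ioc a 1, 0 < u x := pos_of_dv ha.1 le_rfl S.du
    (fun x hx => mul_pos (hC.qp x (hsub x hx)) (hwp x hx)) h2.ge
  exact pos_of_dv ha.1 le_rfl S.dy (fun x hx => hup x ⟨hx.1, hx.2.le⟩) h1.ge 1 ⟨ha.2, le_rfl⟩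

lemma Sys.pos_left {q r : ℝ → ℝ} (hC : Coef q r) {μ : ℝ} (hμ : 0 ≤ μ) {y u w z : ℝ → ℝ}
    (S : Sys q r μ y u w z) {a : ℝ} (ha : a ∈ Ioc (0:ℝ) 1)
    (h1 : y a = 0) (h2 : u a = 0) (h3 : 0 ≤ w a) (h4 : z a ≤ 0) (h5 : w a ≠ 0 ∨ z a ≠ 0) :
    0 < y 0 := by
  have := S.refl.pos_right hC.refl hμ (a := 1 - a) ⟨by linarith [ha.2], by linarith [ha.1]⟩
    (by simpa using h1) (by simpa using h2) (by simpa using h3) (by simpa using h4) (by simpa using h5)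
  simpa using this

/-- No interior double zero. -/
lemma Sys.no_double {q r : ℝ → ℝ} (hC : Coef q r) {μ : ℝ} (hμ : 0 ≤ μ) {y u w z : ℝ → ℝ}
    (S : Sys q r μ y u w z) (hy0 : y 0 = 0) (hy1 : y 1 = 0) (hw0 : w 0 ≠ 0) {a : ℝ}
    (ha : a ∈ Ioo (0:ℝ) 1) (h1 : y a = 0) : u a ≠ 0 := by
  intro h2
  have h5 : w a ≠ 0 ∨ z a ≠ 0 := by
    by_contra hcon
    push Not at hcon
    exact hw0 (S.zero hC hμ ⟨ha.1.le, ha.2.le⟩ h1 h2 hcon.1 hcon.2 0 (by simp)).2.2.1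
  have hR : a ∈ Ico (0:ℝ) 1 := ⟨ha.1.le, ha.2⟩
  have hL : a ∈ Ioc (0:ℝ) 1 := ⟨ha.1, ha.2.le⟩
  rcases le_total 0 (w a) with h3 | h3 <;> rcases le_total 0 (z a) with h4 | h4
  · exact (S.pos_right hC hμ hR h1 h2 h3 h4 h5).ne' hy1
  · exact (S.pos_left hC hμ hL h1 h2 h3 h4 h5).ne' hy0
  · have := S.neg.pos_left hC hμ hL (by simpa using h1) (by simpa using h2) (by simpa using h3)
      (by simpa using h4) (by simpa using h5)
    simp [hy0] at this
  · have := S.neg.pos_right hC hμ hR (by simpa using h1) (by simpa using h2) (by simpa using h3)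
      (by simpa using h4) (by simpa using h5)
    simp [hy1] at this

/-- At a clamped right end the moment is nonzero. -/
lemma Sys.w_one {q r : ℝ → ℝ} (hC : Coef q r) {μ : ℝ} (hμ : 0 ≤ μ) {y u w z : ℝ → ℝ}
    (S : Sys q r μ y u w z) (hy0 : y 0 = 0) (hy1 : y 1 = 0) (hu1 : u 1 = 0) (hw0 : w 0 ≠ 0) :
    w 1 ≠ 0 := by
  intro hw1
  have h5 : w 1 ≠ 0 ∨ z 1 ≠ 0 := by
    by_contra hcon
    push Not at hcon
    exact hw0 (S.zero hC hμ (a := 1) (by simp) hy1 hu1 hcon.1 hcon.2 0 (by simp)).2.2.1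
  rcases le_total 0 (z 1) with h4 | h4
  · have := S.neg.pos_left hC hμ (a := 1) (by simp) (by simpa using hy1) (by simpa using hu1)
      (by simpa using hw1.le) (by simpa using h4) (by simpa using h5)
    simp [hy0] at this
  · exact (S.pos_left hC hμ (a := 1) (by simp) hy1 hu1 hw1.ge h4 h5).ne' hy0


/-! ## Existence and continuous dependence -/

noncomputable def Fv (q r : ℝ → ℝ) (μ t : ℝ) (v : Fin 4 → ℝ) : Fin 4 → ℝ :=
  ![v 1, q t * v 2, v 3, μ * (q t * v 2 + r t * v 0)]

lemma Fv_sub (q r : ℝ → ℝ) (μ t : ℝ) (v v' : Fin 4 → ℝ) :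
    Fv q r μ t v - Fv q r μ t v' = Fv q r μ t (v - v') := by
  ext i; fin_cases i <;> simp [Fv] <;> ring

lemma Fv_sub' (q r : ℝ → ℝ) (μ ν t : ℝ) (v : Fin 4 → ℝ) :
    Fv q r μ t v - Fv q r ν t v = ![0, 0, 0, (μ - ν) * (q t * v 2 + r t * v 0)] := by
  ext i; fin_cases i <;> simp [Fv] <;> ring

lemma aux_comb {B a b s t N : ℝ} (ha : 0 < a) (hb : 0 < b) (haB : a ≤ B) (hbB : b ≤ B)
    (hs : |s| ≤ N) (ht : |t| ≤ N) : |a * s + b * t| ≤ 2 * B * N := by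
  have hB : 0 < B := ha.trans_le haB
  calc |a * s + b * t| ≤ |a * s| + |b * t| := abs_add_le _ _
    _ = a * |s| + b * |t| := by rw [abs_mul, abs_mul, abs_of_pos ha, abs_of_pos hb]
    _ ≤ B * N + B * N := by gcongr
    _ = _ := by ring

lemma Fv_norm {q r : ℝ → ℝ} (hC : Coef q r) {B : ℝ} (hB : 0 < B)
    (hb : ∀ x ∈ Icc (0:ℝ) 1, q x ≤ B ∧ r x ≤ B) (μ : ℝ) {t : ℝ} (ht : t ∈ Icc (0:ℝ) 1)
    (v : Fin 4 → ℝ) : ‖Fv q r μ t v‖ ≤ (1 + B + |μ| * (2 * B)) * ‖v‖ := by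
  have hv : ∀ i, |v i| ≤ ‖v‖ := fun i => norm_le_pi_norm v i
  have hn := norm_nonneg v
  have hK : 0 ≤ |μ| * (2 * B) := by positivity
  have hKn : 0 ≤ |μ| * (2 * B) * ‖v‖ := by positivity
  have hBn : 0 ≤ B * ‖v‖ := by positivity
  rw [pi_norm_le_iff_of_nonneg (by positivity)]
  intro i
  fin_cases i
  · simp only [Fv]
    have := hv 1
    simp
    nlinarith
  · have := hv 2
    have h1 : |q t * v 2| ≤ B * ‖v‖ := by
      rw [abs_mul, abs_of_pos (hC.qp t ht)]
      exact mul_le_mul (hb t ht).1 this (abs_nonneg _) hB.le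
    simp [Fv] at h1 ⊢
    nlinarith
  · have := hv 3
    simp [Fv]
    nlinarith
  · have h1 := aux_comb (hC.qp t ht) (hC.rp t ht) (hb t ht).1 (hb t ht).2 (hv 2) (hv 0)
    have h2 : |μ * (q t * v 2 + r t * v 0)| ≤ |μ| * (2 * B * ‖v‖) := by
      rw [abs_mul]; gcongr
    have h3 : ‖Fv q r μ t v 3‖ ≤ |μ| * (2 * B * ‖v‖) := by
      simpa [Fv] using h2
    exact h3.trans (by nlinarith)

lemma clamp_sub (R a b : ℝ) : |max (-R) (min R a) - max (-R) (min R b)| ≤ |a - b| := by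
  calc |max (-R) (min R a) - max (-R) (min R b)| ≤ |min R a - min R b| := by
        rw [max_comm (-R), max_comm (-R)]; exact abs_max_sub_max_le_abs _ _ _
    _ ≤ |a - b| := by
      rw [abs_le]
      constructor
      · rcases le_total R a with h | h <;> rcases le_total R b with h' | h' <;>
          simp only [min_eq_left h, min_eq_right h, min_eq_left h', min_eq_right h'] <;>
          linarith [neg_abs_le (a - b), abs_nonneg (a-b)]
      · rcases le_total R a with h | h <;> rcases le_total R b with h' | h' <;>
          simp only [min_eq_left h, min_eq_right h, min_eq_left h', min_eq_right h'] <;>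
          linarith [le_abs_self (a - b), abs_nonneg (a-b)]

lemma to_Ici {E : Type*} [NormedAddCommGroup E] [NormedSpace ℝ E] {f : ℝ → E} {f' : E} {x : ℝ}
    (hx : x ∈ Ico (0:ℝ) 1) (h : HasDerivWithinAt f f' (Icc 0 1) x) :
    HasDerivWithinAt f f' (Ici x) x :=
  h.mono_of_mem_nhdsWithin (Icc_mem_nhdsGE_of_mem hx)

lemma exists_sol {q r : ℝ → ℝ} (hC : Coef q r) (μ : ℝ) (x0 : Fin 4 → ℝ) :
    ∃ v : ℝ → Fin 4 → ℝ, v 0 = x0 ∧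
      ∀ t ∈ Icc (0:ℝ) 1, HasDerivWithinAt v (Fv q r μ t (v t)) (Icc 0 1) t := by
  obtain ⟨B, hB, hb⟩ := hC.bdd
  set K := 1 + B + |μ| * (2 * B) with hK
  have hK0 : 0 < K := by positivity
  set R := ‖x0‖ * Real.exp K with hR
  have hR0 : 0 ≤ R := by positivity
  let cl : (Fin 4 → ℝ) → Fin 4 → ℝ := fun v i => max (-R) (min R (v i))
  have hcl1 : ∀ v v', ‖cl v - cl v'‖ ≤ ‖v - v'‖ := by
    intro v v'
    rw [pi_norm_le_iff_of_nonneg (norm_nonneg _)]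
    intro i
    exact (clamp_sub R (v i) (v' i)).trans (norm_le_pi_norm (v - v') i)
  have hcl0 : cl 0 = 0 := by
    ext i; simp [cl, hR0]
  have hcl2 : ∀ v, ‖cl v‖ ≤ R := by
    intro v
    rw [pi_norm_le_iff_of_nonneg hR0]
    intro i
    rw [Real.norm_eq_abs, abs_le]
    simp only [cl]
    exact ⟨le_max_left _ _, max_le (by linarith) (min_le_left _ _)⟩
  have hcl3 : ∀ v, ‖cl v‖ ≤ ‖v‖ := by
    intro v
    simpa [hcl0] using hcl1 v 0
  have hcl4 : ∀ v, ‖v‖ ≤ R → cl v = v := by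
    intro v hv
    ext i
    have := abs_le.1 ((norm_le_pi_norm v i).trans hv)
    simp only [cl]
    rw [min_eq_right this.2, max_eq_right this.1]
  have PL : IsPicardLindelof (fun t v => Fv q r μ t (cl v)) (tmin := 0) (tmax := 1)
      ⟨0, by simp⟩ x0 (K * R).toNNReal 0 (K * R).toNNReal K.toNNReal := by
    constructor
    · intro t ht
      apply LipschitzWith.lipschitzOnWith
      apply LipschitzWith.of_dist_le_mul
      intro v v'
      rw [dist_eq_norm, dist_eq_norm, Fv_sub, Real.coe_toNNReal _ hK0.le]
      exact (Fv_norm hC hB hb μ ht _).trans (by gcongr; exact hcl1 v v')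
    · intro v _
      apply continuousOn_pi.2
      have := hC.qc
      have := hC.rc
      intro i
      fin_cases i <;> simp [Fv] <;> fun_prop
    · intro t ht v _
      rw [Real.coe_toNNReal _ (by positivity)]
      exact (Fv_norm hC hB hb μ ht _).trans (by gcongr; exact hcl2 v)
    · simp
  obtain ⟨v, hv0, hv⟩ := PL.exists_eq_forall_mem_Icc_hasDerivWithinAt₀
  simp only at hv0 hv
  have hbd : ∀ x ∈ Icc (0:ℝ) 1, ‖v x‖ ≤ R := by
    intro x hx
    have := norm_le_gronwallBound_of_norm_deriv_right_le (f := v) (δ := ‖x0‖) (K := K) (ε := 0)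
      (fun x hx => (hv x hx).continuousWithinAt) (fun x hx => to_Ici hx (hv x ⟨hx.1, hx.2.le⟩))
      (by rw [hv0]) (fun x hx => by
        rw [add_zero]
        exact (Fv_norm hC hB hb μ ⟨hx.1, hx.2.le⟩ _).trans (by gcongr; exact hcl3 _)) x hx
    refine this.trans ?_
    rw [gronwallBound_ε0]
    have : K * (x - 0) ≤ K := by nlinarith [hx.2]
    simp only [hR]; gcongr
  refine ⟨v, hv0, fun t ht => ?_⟩
  have := hv t ht
  rwa [hcl4 _ (hbd t ht)] at this

lemma cont_sol {q r : ℝ → ℝ} (hC : Coef q r) {v : ℝ → ℝ → Fin 4 → ℝ} {x0 : Fin 4 → ℝ}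
    (h0 : ∀ μ, v μ 0 = x0)
    (hv : ∀ μ, ∀ t ∈ Icc (0:ℝ) 1, HasDerivWithinAt (v μ) (Fv q r μ t (v μ t)) (Icc 0 1) t)
    (ν : ℝ) {ε : ℝ} (hε : 0 < ε) :
    ∀ᶠ μ in 𝓝 ν, ∀ x ∈ Icc (0:ℝ) 1, ‖v μ x - v ν x‖ < ε := by
  obtain ⟨B, hB, hb⟩ := hC.bdd
  have hcont : ∀ μ, ContinuousOn (v μ) (Icc 0 1) := fun μ x hx => (hv μ x hx).continuousWithinAt
  obtain ⟨M, hM⟩ := isCompact_Icc.exists_bound_of_continuousOn (hcont ν)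
  have hM0 : 0 ≤ M := (norm_nonneg _).trans (hM 0 (by simp))
  set K := 1 + B + (|ν| + 1) * (2 * B) with hK
  have hlim : Tendsto (fun μ => gronwallBound 0 K (|μ - ν| * (2 * B * M)) 1) (𝓝 ν) (𝓝 0) := by
    have c1 : Continuous (fun μ : ℝ => gronwallBound 0 K (|μ - ν| * (2 * B * M)) 1) :=
      (gronwallBound_continuous_ε 0 K 1).comp (by fun_prop)
    have := c1.tendsto ν
    simpa [gronwallBound_ε0_δ0] using this
  have hnear : ∀ᶠ μ in 𝓝 ν, |μ - ν| < 1 := by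
    have := Metric.ball_mem_nhds ν one_pos
    filter_upwards [this] with μ hμ
    simpa [Real.dist_eq] using hμ
  filter_upwards [hlim.eventually (gt_mem_nhds hε), hnear] with μ h1 h2 x hx
  refine lt_of_le_of_lt ?_ h1
  have hμ : |μ| ≤ |ν| + 1 := by
    have := abs_add_le (μ - ν) ν
    simp at this; linarith
  have hG := norm_le_gronwallBound_of_norm_deriv_right_le (f := fun x => v μ x - v ν x)
    (f' := fun x => Fv q r μ x (v μ x) - Fv q r ν x (v ν x)) (δ := 0) (K := K)
    (ε := |μ - ν| * (2 * B * M)) ((hcont μ).sub (hcont ν))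
    (fun x hx => (to_Ici hx (hv μ x ⟨hx.1, hx.2.le⟩)).sub (to_Ici hx (hv ν x ⟨hx.1, hx.2.le⟩)))
    (by simp [h0]) (fun x hx => by
      have hx' : x ∈ Icc (0:ℝ) 1 := ⟨hx.1, hx.2.le⟩
      have e : Fv q r μ x (v μ x) - Fv q r ν x (v ν x) = Fv q r μ x (v μ x - v ν x) +
          ![0, 0, 0, (μ - ν) * (q x * v ν x 2 + r x * v ν x 0)] := by
        rw [← Fv_sub, ← Fv_sub']; abel
      rw [e]
      refine (norm_add_le _ _).trans (add_le_add ?_ ?_)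
      · refine (Fv_norm hC hB hb μ hx' _).trans ?_
        have hle : 1 + B + |μ| * (2 * B) ≤ K := by rw [hK]; gcongr
        exact mul_le_mul_of_nonneg_right hle (norm_nonneg _)
      · rw [pi_norm_le_iff_of_nonneg (by positivity)]
        have hn := hM x hx'
        have h3 := aux_comb (hC.qp x hx') (hC.rp x hx') (hb x hx').1 (hb x hx').2
          ((norm_le_pi_norm (v ν x) 2).trans hn) ((norm_le_pi_norm (v ν x) 0).trans hn)
        have h4 : |(μ - ν) * (q x * v ν x 2 + r x * v ν x 0)| ≤ |μ - ν| * (2 * B * M) := by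
          rw [abs_mul]; gcongr
        have h5 : 0 ≤ |μ - ν| * (2 * B * M) := by positivity
        intro i
        fin_cases i
        · simpa using h5
        · simpa using h5
        · simpa using h5
        · simpa using h4) x hx
  refine hG.trans ?_
  exact gronwallBound_mono le_rfl (by positivity) (by positivity) (by linarith [hx.2])

/-- Continuity in the parameter, uniformly on `[0,1]`. -/
def UC (F : ℝ → ℝ → ℝ) : Prop :=
  (∀ ν, ContinuousOn (F ν) (Icc 0 1)) ∧
  ∀ ν ε, 0 < ε → ∀ᶠ μ in 𝓝 ν, ∀ x ∈ Icc (0:ℝ) 1, |F μ x - F ν x| < ε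

lemma UC.const {f : ℝ → ℝ} (hf : ContinuousOn f (Icc 0 1)) : UC (fun _ => f) :=
  ⟨fun _ => hf, fun ν ε hε => Eventually.of_forall fun μ x _ => by simpa using hε⟩

lemma UC.at {F : ℝ → ℝ → ℝ} (hF : UC F) {a : ℝ} (ha : a ∈ Icc (0:ℝ) 1) : UC (fun μ _ => F μ a) :=
  ⟨fun _ => continuousOn_const, fun ν ε hε => by
    filter_upwards [hF.2 ν ε hε] with μ h x _ using h a ha⟩

lemma UC.sub {F G : ℝ → ℝ → ℝ} (hF : UC F) (hG : UC G) : UC (fun μ x => F μ x - G μ x) := by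
  refine ⟨fun ν => (hF.1 ν).sub (hG.1 ν), fun ν ε hε => ?_⟩
  filter_upwards [hF.2 ν (ε/2) (by linarith), hG.2 ν (ε/2) (by linarith)] with μ h1 h2 x hx
  have e : F μ x - G μ x - (F ν x - G ν x) = (F μ x - F ν x) - (G μ x - G ν x) := by ring
  rw [e]
  have := abs_sub (F μ x - F ν x) (G μ x - G ν x)
  linarith [h1 x hx, h2 x hx]

lemma UC.mul {F G : ℝ → ℝ → ℝ} (hF : UC F) (hG : UC G) : UC (fun μ x => F μ x * G μ x) := by
  refine ⟨fun ν => (hF.1 ν).mul (hG.1 ν), fun ν ε hε => ?_⟩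
  obtain ⟨M, hM⟩ := isCompact_Icc.exists_bound_of_continuousOn (hF.1 ν)
  obtain ⟨N, hN⟩ := isCompact_Icc.exists_bound_of_continuousOn (hG.1 ν)
  have hM0 : 0 ≤ M := (norm_nonneg _).trans (hM 0 (by simp))
  have hN0 : 0 ≤ N := (norm_nonneg _).trans (hN 0 (by simp))
  set η := min 1 (ε / (1 + M + N)) with hη
  have hη0 : 0 < η := by positivity
  have hη1 : η ≤ 1 := min_le_left _ _
  have hη2 : η * (1 + M + N) ≤ ε := by
    have : η ≤ ε / (1 + M + N) := min_le_right _ _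
    rwa [le_div_iff₀ (by positivity)] at this
  filter_upwards [hF.2 ν η hη0, hG.2 ν η hη0] with μ h1 h2 x hx
  have e : F μ x * G μ x - F ν x * G ν x = (F μ x - F ν x) * (G μ x - G ν x)
    + F ν x * (G μ x - G ν x) + (F μ x - F ν x) * G ν x := by ring
  rw [e]
  have k1 := h1 x hx
  have k2 := h2 x hx
  have k3 := hM x hx
  have k4 := hN x hx
  rw [Real.norm_eq_abs] at k3 k4
  have a1 : |(F μ x - F ν x) * (G μ x - G ν x)| < η * 1 := by
    rw [abs_mul]; exact mul_lt_mul'' k1 (k2.trans_le hη1) (abs_nonneg _) (abs_nonneg _)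
  have a2 : |F ν x * (G μ x - G ν x)| ≤ M * η := by
    rw [abs_mul]; gcongr
  have a3 : |(F μ x - F ν x) * G ν x| ≤ η * N := by
    rw [abs_mul]; gcongr
  have := abs_add_three ((F μ x - F ν x) * (G μ x - G ν x)) (F ν x * (G μ x - G ν x)) ((F μ x - F ν x) * G ν x)
  nlinarith

/-- If `F ν` is positive on a compact subinterval, so is `F μ` for nearby `μ`. -/
lemma UC.pos {F : ℝ → ℝ → ℝ} (hF : UC F) {ν : ℝ} {s : Set ℝ} (hs : IsCompact s)
    (hsub : s ⊆ Icc (0:ℝ) 1) (h : ∀ x ∈ s, 0 < F ν x) :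
    ∀ᶠ μ in 𝓝 ν, ∀ x ∈ s, 0 < F μ x := by
  rcases s.eq_empty_or_nonempty with he | hne
  · simp [he]
  obtain ⟨x0, hx0, hmin⟩ := hs.exists_isMinOn hne ((hF.1 ν).mono hsub)
  filter_upwards [hF.2 ν (F ν x0) (h x0 hx0)] with μ h1 x hx
  have h2 := abs_lt.1 (h1 x (hsub hx))
  have h3 : F ν x0 ≤ F ν x := hmin hx
  linarith [h2.1]

lemma UC.ne {F : ℝ → ℝ → ℝ} (hF : UC F) {ν : ℝ} {s : Set ℝ} (hs : IsCompact s)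
    (hsub : s ⊆ Icc (0:ℝ) 1) (h : ∀ x ∈ s, F ν x ≠ 0) :
    ∀ᶠ μ in 𝓝 ν, ∀ x ∈ s, F μ x ≠ 0 := by
  filter_upwards [(hF.mul hF).pos hs hsub (fun x hx => mul_self_pos.2 (h x hx))] with μ h1 x hx
  exact mul_self_pos.1 (h1 x hx)

lemma exists_fund {q r : ℝ → ℝ} (hC : Coef q r) (x0 : Fin 4 → ℝ) :
    ∃ Y U W Z : ℝ → ℝ → ℝ, (∀ μ, Sys q r μ (Y μ) (U μ) (W μ) (Z μ)) ∧
      (∀ μ, Y μ 0 = x0 0 ∧ U μ 0 = x0 1 ∧ W μ 0 = x0 2 ∧ Z μ 0 = x0 3) ∧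
      UC Y ∧ UC U ∧ UC W ∧ UC Z := by
  choose v hv0 hv using fun μ => exists_sol hC μ x0
  have hUC : ∀ i : Fin 4, UC (fun μ x => v μ x i) := by
    intro i
    refine ⟨fun ν x hx => (hasDerivWithinAt_pi.1 (hv ν x hx) i).continuousWithinAt, fun ν ε hε => ?_⟩
    filter_upwards [cont_sol hC hv0 hv ν hε] with μ h x hx
    exact lt_of_le_of_lt (norm_le_pi_norm (v μ x - v ν x) i) (h x hx)
  refine ⟨fun μ x => v μ x 0, fun μ x => v μ x 1, fun μ x => v μ x 2, fun μ x => v μ x 3,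
    fun μ => ⟨fun x hx => ?_, fun x hx => ?_, fun x hx => ?_, fun x hx => ?_⟩, fun μ => ?_,
    hUC 0, hUC 1, hUC 2, hUC 3⟩
  · simpa [Fv] using hasDerivWithinAt_pi.1 (hv μ x hx) 0
  · simpa [Fv] using hasDerivWithinAt_pi.1 (hv μ x hx) 1
  · simpa [Fv] using hasDerivWithinAt_pi.1 (hv μ x hx) 2
  · simpa [Fv] using hasDerivWithinAt_pi.1 (hv μ x hx) 3
  · simp [hv0]

/-- The family of solutions with `y(0) = y'(0) = y(1) = 0`. -/
structure Fam (q r : ℝ → ℝ) (Y U W Z : ℝ → ℝ → ℝ) : Prop where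
  sys : ∀ μ, Sys q r μ (Y μ) (U μ) (W μ) (Z μ)
  y0 : ∀ μ, Y μ 0 = 0
  u0 : ∀ μ, U μ 0 = 0
  y1 : ∀ μ, Y μ 1 = 0
  w0 : ∀ μ, 0 ≤ μ → 0 < W μ 0
  cY : UC Y
  cU : UC U
  cW : UC W
  /-- every solution vanishing doubly at 0 and vanishing at 1 is a multiple -/
  uniq : ∀ μ, 0 ≤ μ → ∀ y u w z, Sys q r μ y u w z → y 0 = 0 → u 0 = 0 → y 1 = 0 →
    ∃ k : ℝ, ∀ x ∈ Icc (0:ℝ) 1, y x = k * Y μ x ∧ u x = k * U μ x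

lemma exists_fam {q r : ℝ → ℝ} (hC : Coef q r) : ∃ Y U W Z, Fam q r Y U W Z := by
  obtain ⟨Y, U, W, Z, S, I, cY, cU, cW, cZ⟩ := exists_fund hC ![0, 0, 1, 0]
  obtain ⟨Y', U', W', Z', S', I', cY', cU', cW', cZ'⟩ := exists_fund hC ![0, 0, 0, 1]
  simp only [Matrix.cons_val] at I I'
  have m1 : (1:ℝ) ∈ Icc (0:ℝ) 1 := by simp
  have hp' : ∀ μ, 0 ≤ μ → 0 < Y' μ 1 := fun μ hμ =>
    (S' μ).pos_right hC hμ (a := 0) (by simp) (I' μ).1 (I' μ).2.1 (by simp [I' μ]) (by simp [I' μ])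
      (by simp [I' μ])
  refine ⟨fun μ x => Y' μ 1 * Y μ x + (- Y μ 1) * Y' μ x, fun μ x => Y' μ 1 * U μ x + (- Y μ 1) * U' μ x,
    fun μ x => Y' μ 1 * W μ x + (- Y μ 1) * W' μ x, fun μ x => Y' μ 1 * Z μ x + (- Y μ 1) * Z' μ x,
    ⟨fun μ => (S μ).lin (S' μ) _ _, fun μ => by simp [I μ, I' μ], fun μ => by simp [I μ, I' μ],
      fun μ => by ring, fun μ hμ => by simpa [I μ, I' μ] using hp' μ hμ, ?_, ?_, ?_, ?_⟩⟩
  · simpa [sub_eq_add_neg] using ((cY'.at m1).mul cY).sub ((cY.at m1).mul cY')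
  · simpa [sub_eq_add_neg] using ((cY'.at m1).mul cU).sub ((cY.at m1).mul cU')
  · simpa [sub_eq_add_neg] using ((cY'.at m1).mul cW).sub ((cY.at m1).mul cW')
  · intro μ hμ y u w z T h0 h1 h2
    have D := (T.lin ((S μ).lin (S' μ) (w 0) (z 0)) 1 (-1)).zero hC hμ (a := 0) (by simp)
      (by simp [I μ, I' μ, h0]) (by simp [I μ, I' μ, h1]) (by simp [I μ, I' μ]) (by simp [I μ, I' μ])
    have e1 := (D 1 m1).1
    have hp := hp' μ hμ
    rw [h2] at e1
    have hz : z 0 = - (w 0 * Y μ 1) / Y' μ 1 := by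
      field_simp; linarith
    refine ⟨w 0 / Y' μ 1, fun x hx => ⟨?_, ?_⟩⟩
    · have := (D x hx).1
      rw [hz] at this
      have e2 : y x = w 0 * Y μ x + - (w 0 * Y μ 1) / Y' μ 1 * Y' μ x := by linarith
      rw [e2]; field_simp
    · have := (D x hx).2.1
      rw [hz] at this
      have e2 : u x = w 0 * U μ x + - (w 0 * Y μ 1) / Y' μ 1 * U' μ x := by linarith
      rw [e2]; field_simp


/-! ## Stability of the number of zeros -/

lemma finite_zeros {f f' : ℝ → ℝ} (d : ∀ x ∈ Icc (0:ℝ) 1, HasDerivWithinAt f (f' x) (Icc 0 1) x)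
    {a b : ℝ} (ha : 0 < a) (hb : b < 1)
    (hs : ∀ x ∈ Icc a b, f x = 0 → f' x ≠ 0) : {x ∈ Icc a b | f x = 0}.Finite := by
  by_contra hinf
  have hsub : Icc a b ⊆ Icc (0:ℝ) 1 := Icc_subset_Icc ha.le hb.le
  obtain ⟨x, hx, hacc⟩ := Set.Infinite.exists_accPt_of_subset_isCompact hinf
    (isCompact_Icc (a := a) (b := b)) (fun x hx => hx.1)
  have hx01 : x ∈ Ioo (0:ℝ) 1 := ⟨ha.trans_le hx.1, hx.2.trans_lt hb⟩
  have hd := hasDerivAt_of_dv d hx01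
  rw [accPt_iff_frequently_nhdsNE] at hacc
  by_cases h0 : f x = 0
  · have := hd.eventually_ne (c := 0) (hs x hx h0)
    obtain ⟨t, ht1, ht2⟩ := (hacc.and_eventually this).exists
    exact ht2 ht1.2
  · have : ∀ᶠ t in 𝓝[≠] x, f t ≠ 0 :=
      (hd.continuousAt.eventually_ne h0).filter_mono nhdsWithin_le_nhds
    obtain ⟨t, ht1, ht2⟩ := (hacc.and_eventually this).exists
    exact ht2 ht1.2

lemma count_stable {F F' : ℝ → ℝ → ℝ} (cF : UC F) (cF' : UC F')
    (d : ∀ μ, ∀ x ∈ Icc (0:ℝ) 1, HasDerivWithinAt (F μ) (F' μ x) (Icc 0 1) x)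
    {ν a b : ℝ} (ha : 0 < a) (hb : b < 1) (hFa : F ν a ≠ 0) (hFb : F ν b ≠ 0)
    (hs : ∀ x ∈ Icc a b, F ν x = 0 → F' ν x ≠ 0) :
    ∀ᶠ μ in 𝓝 ν, {x ∈ Icc a b | F μ x = 0}.Finite ∧
      {x ∈ Icc a b | F μ x = 0}.ncard = {x ∈ Icc a b | F ν x = 0}.ncard := by
  have hfin := finite_zeros (d ν) ha hb hs
  set Z := {x ∈ Icc a b | F ν x = 0} with hZ
  have hsub : Icc a b ⊆ Icc (0:ℝ) 1 := Icc_subset_Icc ha.le hb.le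
  have hab : ∀ z ∈ Z, z ∈ Ioo a b := by
    intro z hz
    refine ⟨lt_of_le_of_ne hz.1.1 ?_, lt_of_le_of_ne hz.1.2 ?_⟩
    · rintro rfl; exact hFa hz.2
    · rintro rfl; exact hFb hz.2
  have hloc : ∀ z ∈ Z, ∀ᶠ ε in 𝓝[>] (0:ℝ), ∀ x ∈ Icc (z - ε) (z + ε),
      x ∈ Icc a b ∧ 0 < F' ν z * F' ν x := by
    intro z hz
    have hz' := hab z hz
    have hc : ContinuousAt (F' ν) z := (cF'.1 ν).continuousAt
      (Icc_mem_nhds (ha.trans hz'.1) (hz'.2.trans hb))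
    have h1 : ∀ᶠ x in 𝓝 z, 0 < F' ν z * F' ν x := by
      have : ContinuousAt (fun x => F' ν z * F' ν x) z := by fun_prop
      exact this.eventually (lt_mem_nhds (mul_self_pos.2 (hs z hz.1 hz.2)))
    have h2 : ∀ᶠ x in 𝓝 z, x ∈ Icc a b := Icc_mem_nhds hz'.1 hz'.2
    obtain ⟨e, he, hball⟩ := Metric.nhds_basis_closedBall.eventually_iff.1 (h2.and h1)
    filter_upwards [Ioc_mem_nhdsGT he] with ε hε x hx
    apply hball
    rw [Metric.mem_closedBall, Real.dist_eq, abs_le]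
    constructor <;> linarith [hx.1, hx.2, hε.2]
  obtain ⟨ε, hε, hε0⟩ := (((eventually_all_finite hfin).2 hloc).and self_mem_nhdsWithin).exists
  have hε0 : 0 < ε := hε0
  have smono : ∀ μ k c e, Icc c e ⊆ Icc a b → (∀ x ∈ Icc c e, 0 < k * F' μ x) →
      StrictMonoOn (fun x => k * F μ x) (Icc c e) := by
    intro μ k c e hce hpos
    rcases le_or_gt c e with h | h
    · have h1 := hsub (hce (left_mem_Icc.2 h))
      have h2 := hsub (hce (right_mem_Icc.2 h))
      exact smono_of_dv h1.1 h2.2 (fun x hx => (d μ x hx).const_mul k)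
        (fun x hx => hpos x ⟨hx.1.le, hx.2.le⟩)
    · rw [Icc_eq_empty (by linarith)]; simp [StrictMonoOn]
  set δ := ε / 2 with hδ
  have hδ0 : 0 < δ := by positivity
  have hεδ : ∀ z, Icc (z - δ) (z + δ) ⊆ Icc (z - ε) (z + ε) :=
    fun z => Icc_subset_Icc (by linarith) (by linarith)
  have hballab : ∀ z ∈ Z, Icc (z - δ) (z + δ) ⊆ Icc a b := fun z hz x hx => (hε z hz x (hεδ z hx)).1
  have mem0 : ∀ z : ℝ, z ∈ Icc (z - δ) (z + δ) := fun z => ⟨by linarith, by linarith⟩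
  have meml : ∀ z : ℝ, z - δ ∈ Icc (z - δ) (z + δ) := fun z => ⟨by linarith, by linarith⟩
  have memr : ∀ z : ℝ, z + δ ∈ Icc (z - δ) (z + δ) := fun z => ⟨by linarith, by linarith⟩
  have hsep : ∀ z ∈ Z, ∀ z' ∈ Z, |z - z'| ≤ ε → z = z' := by
    intro z hz z' hz' h
    have hm := smono ν (F' ν z) (z - ε) (z + ε) (fun x hx => (hε z hz x hx).1)
      (fun x hx => (hε z hz x hx).2)
    have := abs_le.1 h
    refine hm.injOn ⟨by linarith, by linarith⟩ ⟨by linarith, by linarith⟩ ?_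
    simp [hz.2, hz'.2]
  have hkn : ∀ z ∈ Z, StrictMonoOn (fun x => F' ν z * F ν x) (Icc (z - δ) (z + δ)) := fun z hz =>
    smono ν (F' ν z) _ _ (hballab z hz) (fun x hx => (hε z hz x (hεδ z hx)).2)
  have E1 : ∀ᶠ μ in 𝓝 ν, ∀ z ∈ Z, ∀ x ∈ Icc (z - δ) (z + δ), 0 < F' ν z * F' μ x := by
    refine (eventually_all_finite hfin).2 fun z hz => ?_
    exact ((UC.const (f := fun _ => F' ν z) continuousOn_const).mul cF').pos isCompact_Icc
      ((hballab z hz).trans hsub) (fun x hx => (hε z hz x (hεδ z hx)).2)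
  have E2 : ∀ᶠ μ in 𝓝 ν, ∀ z ∈ Z, ∀ x ∈ ({z + δ} : Set ℝ), 0 < F' ν z * F μ x := by
    refine (eventually_all_finite hfin).2 fun z hz => ?_
    refine ((UC.const (f := fun _ => F' ν z) continuousOn_const).mul cF).pos isCompact_singleton
      ?_ ?_
    · rw [singleton_subset_iff]; exact hsub (hballab z hz (memr z))
    · rintro x rfl
      have := hkn z hz (mem0 z) (memr z) (by linarith)
      simpa [hz.2] using this
  have E3 : ∀ᶠ μ in 𝓝 ν, ∀ z ∈ Z, ∀ x ∈ ({z - δ} : Set ℝ), 0 < (- F' ν z) * F μ x := by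
    refine (eventually_all_finite hfin).2 fun z hz => ?_
    refine ((UC.const (f := fun _ => - F' ν z) continuousOn_const).mul cF).pos isCompact_singleton
      ?_ ?_
    · rw [singleton_subset_iff]; exact hsub (hballab z hz (meml z))
    · rintro x rfl
      have := hkn z hz (meml z) (mem0 z) (by linarith)
      simpa [hz.2] using this
  have E4 : ∀ᶠ μ in 𝓝 ν, ∀ x ∈ Icc a b \ ⋃ z ∈ Z, Ioo (z - δ) (z + δ), F μ x ≠ 0 := by
    refine cF.ne ?_ (sdiff_subset.trans hsub) ?_
    · exact isCompact_Icc.diff (isOpen_biUnion fun z _ => isOpen_Ioo)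
    · rintro x ⟨hx, hx'⟩ h0
      apply hx'
      have hxZ : x ∈ Z := ⟨hx, h0⟩
      exact mem_biUnion hxZ ⟨by linarith, by linarith⟩
  filter_upwards [E1, E2, E3, E4] with μ h1 h2 h3 h4
  have hroot : ∀ z ∈ Z, ∃ x ∈ Ioo (z - δ) (z + δ), F μ x = 0 := by
    intro z hz
    have hc : ContinuousOn (fun x => F' ν z * F μ x) (Icc (z - δ) (z + δ)) :=
      continuousOn_const.mul ((cF.1 μ).mono ((hballab z hz).trans hsub))
    have hi := intermediate_value_Ioo (by linarith : z - δ ≤ z + δ) hc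
    have hk := h3 z hz _ rfl
    obtain ⟨x, hx, hx0⟩ := hi (show (0:ℝ) ∈ _ from ⟨by linarith, h2 z hz _ rfl⟩)
    refine ⟨x, hx, ?_⟩
    rcases mul_eq_zero.1 hx0 with h | h
    · exact absurd h (hs z hz.1 hz.2)
    · exact h
  choose! ξ hξ hξ0 using hroot
  have himg : {x ∈ Icc a b | F μ x = 0} = ξ '' Z := by
    ext x
    constructor
    · rintro ⟨hx, hx0⟩
      by_cases hu : x ∈ ⋃ z ∈ Z, Ioo (z - δ) (z + δ)
      · obtain ⟨z, hz, hxz⟩ := mem_iUnion₂.1 hu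
        refine ⟨z, hz, ?_⟩
        have hm := smono μ (F' ν z) (z - δ) (z + δ) (hballab z hz) (h1 z hz)
        refine hm.injOn (Ioo_subset_Icc_self (hξ z hz)) (Ioo_subset_Icc_self hxz) ?_
        simp [hx0, hξ0 z hz]
      · exact absurd hx0 (h4 x ⟨hx, hu⟩)
    · rintro ⟨z, hz, rfl⟩
      exact ⟨hballab z hz (Ioo_subset_Icc_self (hξ z hz)), hξ0 z hz⟩
  have hinj : InjOn ξ Z := by
    intro z hz z' hz' he
    apply hsep z hz z' hz'
    have k1 := hξ z hz
    have k2 := hξ z' hz'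
    rw [← he] at k2
    rw [abs_le]
    constructor <;> linarith [k1.1, k1.2, k2.1, k2.2]
  rw [himg]
  exact ⟨hfin.image _, hinj.ncard_image⟩


/-! ## Local behaviour of the zero count in the parameter -/

lemma int_of_dv {f g : ℝ → ℝ} (d : ∀ x ∈ Icc (0:ℝ) 1, HasDerivWithinAt f (g x) (Icc 0 1) x)
    (hg : ContinuousOn g (Icc 0 1)) : ∫ x in (0:ℝ)..1, g x = f 1 - f 0 :=
  intervalIntegral.integral_eq_sub_of_hasDerivAt_of_le zero_le_one (contOn_of_dv d)
    (fun _ hx => hasDerivAt_of_dv d hx) (hg.intervalIntegrable_of_Icc zero_le_one)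

lemma crossing {q r : ℝ → ℝ} (hC : Coef q r) {Y U W Z : ℝ → ℝ → ℝ} (hF : Fam q r Y U W Z)
    {ν : ℝ} (hν : 0 ≤ ν) (hU : U ν 1 = 0) :
    0 < ν ∧ ∀ᶠ μ in 𝓝 ν, (ν < μ → 0 < W ν 1 * U μ 1) ∧ (μ ≤ ν → W ν 1 * U μ 1 ≤ 0) := by
  set g : ℝ → ℝ → ℝ := fun μ x => r x * (Y μ x * Y ν x) - U μ x * U ν x with hg
  have S0 := hF.sys ν
  have cg : UC g := ((UC.const hC.rc).mul (hF.cY.mul (UC.const (hF.cY.1 ν)))).sub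
    (hF.cU.mul (UC.const (hF.cU.1 ν)))
  have cq := hC.qc
  have cW := hF.cW.1 ν
  have id1 : ∀ μ, (μ - ν) * (∫ x in (0:ℝ)..1, g μ x) = W ν 1 * U μ 1 := by
    intro μ
    have S := hF.sys μ
    rw [← intervalIntegral.integral_const_mul]
    rw [int_of_dv (g := fun x => (μ - ν) * g μ x) (f := fun x => Z μ x * Y ν x - W μ x * U ν x + U μ x * W ν x - Y μ x * Z ν x
      - μ * (U μ x * Y ν x) + ν * (U ν x * Y μ x)) ?_ (continuousOn_const.mul (cg.1 μ))]
    · simp [hF.y0, hF.u0, hF.y1, hU]; ring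
    · intro x hx
      refine (((((((S.dz x hx).mul (S0.dy x hx)).sub ((S.dw x hx).mul (S0.du x hx))).add
        ((S.du x hx).mul (S0.dw x hx))).sub ((S.dy x hx).mul (S0.dz x hx))).sub
        (((S.du x hx).mul (S0.dy x hx)).const_mul μ)).add
        (((S0.du x hx).mul (S.dy x hx)).const_mul ν)).congr_deriv ?_
      simp only [hg]; ring
  have id2 : ν * (∫ x in (0:ℝ)..1, g ν x) = ∫ x in (0:ℝ)..1, q x * (W ν x * W ν x) := by
    have c2 : ContinuousOn (fun x => q x * (W ν x * W ν x)) (Icc 0 1) := by fun_prop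
    have c1 : ContinuousOn (fun x => ν * g ν x) (Icc 0 1) := continuousOn_const.mul (cg.1 ν)
    rw [← intervalIntegral.integral_const_mul, ← sub_eq_zero, ← intervalIntegral.integral_sub
      (c1.intervalIntegrable_of_Icc zero_le_one) (c2.intervalIntegrable_of_Icc zero_le_one)]
    rw [int_of_dv (g := fun x => ν * g ν x - q x * (W ν x * W ν x))
      (f := fun x => Z ν x * Y ν x - W ν x * U ν x - ν * (U ν x * Y ν x)) ?_ (c1.sub c2)]
    · simp [hF.y0, hF.u0, hF.y1, hU]
    · intro x hx
      refine ((((S0.dz x hx).mul (S0.dy x hx)).sub ((S0.dw x hx).mul (S0.du x hx))).sub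
        (((S0.du x hx).mul (S0.dy x hx)).const_mul ν)).congr_deriv ?_
      simp only [hg]; ring
  have hpos : 0 < ∫ x in (0:ℝ)..1, q x * (W ν x * W ν x) := by
    refine intervalIntegral.integral_pos zero_lt_one (by fun_prop) ?_ ⟨0, by simp, ?_⟩
    · intro x hx
      exact mul_nonneg (hC.qp x ⟨hx.1.le, hx.2⟩).le (mul_self_nonneg _)
    · have := hF.w0 ν hν
      have := hC.qp 0 (by simp)
      positivity
  rw [← id2] at hpos
  have hν0 : 0 < ν := by
    rcases hν.eq_or_lt with h | h
    · rw [← h] at hpos; simp at hpos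
    · exact h
  have hI : 0 < ∫ x in (0:ℝ)..1, g ν x := by
    by_contra hcon
    push Not at hcon
    nlinarith
  set I := ∫ x in (0:ℝ)..1, g ν x with hId
  refine ⟨hν0, ?_⟩
  filter_upwards [cg.2 ν (I/2) (by linarith)] with μ hμ
  have hIμ : 0 < ∫ x in (0:ℝ)..1, g μ x := by
    have h1 := intervalIntegral.norm_integral_le_of_norm_le_const (a := 0) (b := 1)
      (f := fun x => g μ x - g ν x) (C := I/2) (fun x hx => by
        rw [uIoc_of_le zero_le_one] at hx
        exact (hμ x ⟨hx.1.le, hx.2⟩).le)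
    rw [intervalIntegral.integral_sub ((cg.1 μ).intervalIntegrable_of_Icc zero_le_one)
      ((cg.1 ν).intervalIntegrable_of_Icc zero_le_one)] at h1
    have h2 := abs_le.1 h1
    simp only [sub_zero, abs_one, mul_one] at h2
    linarith [h2.1]
  rw [← id1 μ]
  constructor
  · intro h; exact mul_pos (by linarith) hIμ
  · intro h; exact mul_nonpos_of_nonpos_of_nonneg (by linarith) hIμ.le

lemma set_eq {y : ℝ → ℝ} {a b : ℝ} (ha : 0 < a) (hb : b < 1)
    (h1 : ∀ x ∈ Ioc 0 a, y x ≠ 0) (h2 : ∀ x ∈ Ico b 1, y x ≠ 0) :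
    {x ∈ Ioo (0:ℝ) 1 | y x = 0} = {x ∈ Icc a b | y x = 0} := by
  ext x
  constructor
  · rintro ⟨hx, h0⟩
    refine ⟨⟨?_, ?_⟩, h0⟩
    · by_contra hcon
      exact h1 x ⟨hx.1, by linarith⟩ h0
    · by_contra hcon
      exact h2 x ⟨by linarith, hx.2⟩ h0
  · rintro ⟨hx, h0⟩
    exact ⟨⟨ha.trans_le hx.1, hx.2.trans_lt hb⟩, h0⟩

lemma set_eq' {y : ℝ → ℝ} {a b : ℝ} (ha : 0 < a) (hab : a < b) (hb : b < 1)
    (h1 : ∀ x ∈ Ioc 0 a, y x ≠ 0) {t : ℝ} (ht : t ∈ Ioo b 1) (hyt : y t = 0)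
    (h2 : ∀ x ∈ Ioo b 1, y x = 0 → x = t) :
    {x ∈ Ioo (0:ℝ) 1 | y x = 0} = insert t {x ∈ Icc a b | y x = 0} := by
  ext x
  simp only [mem_insert_iff]
  constructor
  · rintro ⟨hx, h0⟩
    rcases le_or_gt x b with h | h
    · right
      refine ⟨⟨?_, h⟩, h0⟩
      by_contra hcon
      exact h1 x ⟨hx.1, by linarith⟩ h0
    · left; exact h2 x ⟨h, hx.2⟩ h0
  · rintro (rfl | ⟨hx, h0⟩)
    · exact ⟨⟨by linarith [ht.1], ht.2⟩, hyt⟩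
    · exact ⟨⟨ha.trans_le hx.1, hx.2.trans_lt hb⟩, h0⟩

/-- Positivity near the right end point. -/
lemma exists_right {f : ℝ → ℝ} (hf : ContinuousOn f (Icc 0 1)) (h : 0 < f 1) {c : ℝ} (hc0 : 0 ≤ c) (hc : c < 1) :
    ∃ b, c < b ∧ b < 1 ∧ ∀ x ∈ Icc b 1, 0 < f x := by
  have h1 : ∀ᶠ x in 𝓝[≤] (1:ℝ), 0 < f x := by
    have : ContinuousWithinAt f (Iic 1) 1 :=
      (hf 1 (by simp)).mono_of_mem_nhdsWithin (Icc_mem_nhdsLE zero_lt_one)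
    exact this.eventually (lt_mem_nhds h)
  obtain ⟨l, hl, hl'⟩ := (mem_nhdsLE_iff_exists_Ioc_subset).1 h1
  have hl : l < 1 := hl
  refine ⟨(max l c + 1)/2, ?_, ?_, ?_⟩
  · have := le_max_right l c; linarith
  · have := max_lt hl hc; linarith
  · intro x hx
    have := le_max_left l c
    have := max_lt hl hc
    exact hl' ⟨by linarith [hx.1], hx.2⟩

lemma exists_left {f : ℝ → ℝ} (hf : ContinuousOn f (Icc 0 1)) (h : 0 < f 0) :
    ∃ a, 0 < a ∧ a < 1/2 ∧ ∀ x ∈ Icc 0 a, 0 < f x := by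
  obtain ⟨b, h1, h2, h3⟩ := exists_right (f := fun x => f (1 - x)) (c := 1/2)
    (hf.comp (by fun_prop) (fun x hx => refl_mem hx)) (by simpa using h) (by norm_num) (by norm_num)
  refine ⟨1 - b, by linarith, by linarith, fun x hx => ?_⟩
  have := h3 (1 - x) ⟨by linarith [hx.2], by linarith [hx.1]⟩
  simpa using this

lemma local_step {q r : ℝ → ℝ} (hC : Coef q r) {Y U W Z : ℝ → ℝ → ℝ} (hF : Fam q r Y U W Z)
    {ν : ℝ} (hν : 0 ≤ ν) :
    {x ∈ Ioo (0:ℝ) 1 | Y ν x = 0}.Finite ∧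
    ∀ᶠ μ in 𝓝 ν, 
      ((U ν 1 ≠ 0 ∨ μ ≤ ν) →
        {x ∈ Ioo (0:ℝ) 1 | Y μ x = 0}.ncard = {x ∈ Ioo (0:ℝ) 1 | Y ν x = 0}.ncard) ∧
      (U ν 1 = 0 → ν < μ →
        {x ∈ Ioo (0:ℝ) 1 | Y μ x = 0}.ncard = {x ∈ Ioo (0:ℝ) 1 | Y ν x = 0}.ncard + 1) := by
  have S := hF.sys
  have hsimple : ∀ x ∈ Ioo (0:ℝ) 1, Y ν x = 0 → U ν x ≠ 0 := fun x hx h0 =>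
    (S ν).no_double hC hν (hF.y0 ν) (hF.y1 ν) (hF.w0 ν hν).ne' hx h0
  obtain ⟨a, ha, ha2, hWa⟩ := exists_left (hF.cW.1 ν) (hF.w0 ν hν)
  have EL : ∀ᶠ μ in 𝓝 ν, ∀ x ∈ Ioc 0 a, Y μ x ≠ 0 := by
    filter_upwards [hF.cW.pos isCompact_Icc (Icc_subset_Icc le_rfl (by linarith)) hWa] with μ hμ x hx
    have hu : ∀ x ∈ Ioc 0 a, 0 < U μ x := pos_of_dv le_rfl (by linarith) (S μ).du
      (fun x hx => mul_pos (hC.qp x ⟨hx.1.le, by linarith [hx.2]⟩) (hμ x ⟨hx.1.le, hx.2.le⟩))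
      (hF.u0 μ).ge
    exact (pos_of_dv le_rfl (by linarith) (S μ).dy (fun x hx => hu x ⟨hx.1, hx.2.le⟩)
      (hF.y0 μ).ge x hx).ne'
  have ELν := EL.self_of_nhds
  by_cases hU : U ν 1 = 0
  · -- crossing case
    set k := W ν 1 with hk
    have hk0 : k ≠ 0 := (S ν).w_one hC hν (hF.y0 ν) (hF.y1 ν) hU (hF.w0 ν hν).ne'
    obtain ⟨b, hb2, hb, hWb⟩ := exists_right (f := fun x => k * W ν x) (c := 1/2)
      (continuousOn_const.mul (hF.cW.1 ν)) (mul_self_pos.2 hk0) (by norm_num) (by norm_num)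
    have hsubb : Icc b 1 ⊆ Icc (0:ℝ) 1 := Icc_subset_Icc (by linarith) le_rfl
    have EW := ((UC.const (f := fun _ => k) continuousOn_const).mul hF.cW).pos isCompact_Icc hsubb hWb
    obtain ⟨_, hcr⟩ := crossing hC hF hν hU
    have hUm : ∀ μ, (∀ x ∈ Icc b 1, 0 < k * W μ x) → StrictMonoOn (fun x => k * U μ x) (Icc b 1) := by
      intro μ hμ
      refine smono_of_dv (by linarith) le_rfl (fun x hx => ((S μ).du x hx).const_mul k) ?_
      intro x hx
      have := mul_pos (hC.qp x (hsubb ⟨hx.1.le, hx.2.le⟩)) (hμ x ⟨hx.1.le, hx.2.le⟩)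
      linarith
    have hneg : ∀ μ, (∀ x ∈ Icc b 1, 0 < k * W μ x) → k * U μ 1 ≤ 0 →
        ∀ x ∈ Ico b 1, 0 < k * Y μ x := by
      intro μ hμ hle x hx
      have hm := hUm μ hμ
      have := smono_of_dv (f := fun x => (-k) * Y μ x) (g := fun x => (-k) * U μ x) (a := b) (b := 1)
        (by linarith) le_rfl (fun x hx => ((S μ).dy x hx).const_mul (-k)) (by
          intro t ht
          have := hm ⟨ht.1.le, ht.2.le⟩ (right_mem_Icc.2 hb.le) ht.2
          simp only at this
          linarith) ⟨hx.1, hx.2.le⟩ (right_mem_Icc.2 hb.le) hx.2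
      simp only [hF.y1] at this
      linarith
    have hYb := hneg ν hWb (by rw [hU]; simp) b ⟨le_rfl, hb⟩
    have hYbν : Y ν b ≠ 0 := fun h => by rw [h] at hYb; simp at hYb
    have hsν : ∀ x ∈ Icc a b, Y ν x = 0 → U ν x ≠ 0 := fun x hx =>
      hsimple x ⟨ha.trans_le hx.1, hx.2.trans_lt hb⟩
    have hcount := count_stable hF.cY hF.cU (fun μ => (S μ).dy) ha hb (ELν a ⟨ha, le_rfl⟩) hYbν hsν
    have hnz : ∀ μ, (∀ x ∈ Icc b 1, 0 < k * W μ x) → k * U μ 1 ≤ 0 →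
        ∀ x ∈ Ico b 1, Y μ x ≠ 0 := fun μ h1 h2 x hx h0 => by
      have := hneg μ h1 h2 x hx
      rw [h0] at this; simp at this
    have hsetν := set_eq ha hb ELν (hnz ν hWb (by rw [hU]; simp))
    refine ⟨?_, ?_⟩
    · rw [hsetν]; exact finite_zeros (S ν).dy ha hb hsν
    have EY := ((UC.const (f := fun _ => k) continuousOn_const).mul hF.cY).pos
      (s := {b}) isCompact_singleton (by rw [singleton_subset_iff]; exact hsubb (left_mem_Icc.2 hb.le))
      (ν := ν) (by rintro x rfl; exact hYb)
    filter_upwards [EL, EW, hcr, hcount, EY] with μ e1 e2 e3 e4 e5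
    refine ⟨fun h => ?_, fun _ hlt => ?_⟩
    · have hle : μ ≤ ν := by
        rcases h with h | h
        · exact absurd hU h
        · exact h
      rw [hsetν, set_eq ha hb e1 (hnz μ e2 (e3.2 hle))]
      exact e4.2
    · have hup := e3.1 hlt
      have hm := hUm μ e2
      obtain ⟨c, hbc, hc1, hcU⟩ := exists_right (f := fun x => k * U μ x) (c := b)
        (continuousOn_const.mul (hF.cU.1 μ)) hup (by linarith) hb
      have hYc : k * Y μ c < 0 := by
        have := smono_of_dv (f := fun x => k * Y μ x) (g := fun x => k * U μ x) (a := c) (b := 1)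
          (by linarith) le_rfl (fun x hx => ((S μ).dy x hx).const_mul k)
          (fun x hx => hcU x ⟨hx.1.le, hx.2.le⟩) (left_mem_Icc.2 hc1.le) (right_mem_Icc.2 hc1.le) hc1
        simpa [hF.y1] using this
      have hcont : ContinuousOn (fun x => k * Y μ x) (Icc 0 1) := continuousOn_const.mul (hF.cY.1 μ)
      have hYb' := e5 b rfl
      obtain ⟨t, ht, ht0⟩ := intermediate_value_Ioo' hbc.le (hcont.mono (Icc_subset_Icc (by linarith) hc1.le))
        (show (0:ℝ) ∈ _ from ⟨hYc, hYb'⟩)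
      have ht0' : Y μ t = 0 := by
        rcases mul_eq_zero.1 ht0 with h | h
        · exact absurd h hk0
        · exact h
      -- Rolle
      have rolle : ∀ s s', b < s → s < s' → s' ≤ 1 → Y μ s = 0 → Y μ s' = 0 →
          ∃ m ∈ Ioo s s', U μ m = 0 := by
        intro s s' h1 h2 h3 h4 h5
        refine exists_hasDerivAt_eq_zero h2 ((hF.cY.1 μ).mono (Icc_subset_Icc (by linarith) h3))
          (by rw [h4, h5]) (fun x hx => hasDerivAt_of_dv (S μ).dy ⟨by linarith [hx.1], by linarith [hx.2]⟩)
      have nothree : ∀ s s', b < s → s < s' → s' < 1 → Y μ s = 0 → Y μ s' = 0 → False := by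
        intro s s' h1 h2 h3 h4 h5
        obtain ⟨m, hm1, hm2⟩ := rolle s s' h1 h2 h3.le h4 h5
        obtain ⟨m', hm1', hm2'⟩ := rolle s' 1 (h1.trans h2) h3 le_rfl h5 (hF.y1 μ)
        have := hm (a := m) (b := m') ⟨by linarith [hm1.1], by linarith [hm1.2]⟩
          ⟨by linarith [hm1'.1], by linarith [hm1'.2]⟩ (by linarith [hm1.2, hm1'.1])
        simp [hm2, hm2'] at this
      have hmem : t ∈ Ioo b 1 := ⟨ht.1, ht.2.trans hc1⟩
      rw [set_eq' ha (by linarith) hb e1 hmem ht0' (fun x hx h0 => by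
        rcases lt_trichotomy x t with h | h | h
        · exact (nothree x t hx.1 h hmem.2 h0 ht0').elim
        · exact h
        · exact (nothree t x hmem.1 h hx.2 ht0' h0).elim),
        hsetν, ncard_insert_of_notMem (fun h => by linarith [h.1.2, hmem.1]) e4.1, e4.2]
  · obtain ⟨b, hb2, hb, hUb⟩ := exists_right (f := fun x => U ν 1 * U ν x) (c := 1/2)
      (continuousOn_const.mul (hF.cU.1 ν)) (mul_self_pos.2 hU) (by norm_num) (by norm_num)
    have hsubb : Icc b 1 ⊆ Icc (0:ℝ) 1 := Icc_subset_Icc (by linarith) le_rfl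
    have ER : ∀ᶠ μ in 𝓝 ν, ∀ x ∈ Ico b 1, Y μ x ≠ 0 := by
      filter_upwards [((UC.const (f := fun _ => U ν 1) continuousOn_const).mul hF.cU).pos
        isCompact_Icc hsubb hUb] with μ hμ x hx h0
      have := smono_of_dv (f := fun x => U ν 1 * Y μ x) (g := fun x => U ν 1 * U μ x) (a := b) (b := 1)
        (by linarith) le_rfl (fun x hx => ((S μ).dy x hx).const_mul _)
        (fun x hx => hμ x ⟨hx.1.le, hx.2.le⟩) ⟨hx.1, hx.2.le⟩ (right_mem_Icc.2 hb.le) hx.2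
      simp [hF.y1, h0] at this
    have ERν := ER.self_of_nhds
    have hsetν := set_eq ha hb ELν ERν
    have hsν : ∀ x ∈ Icc a b, Y ν x = 0 → U ν x ≠ 0 := fun x hx =>
      hsimple x ⟨ha.trans_le hx.1, hx.2.trans_lt hb⟩
    refine ⟨?_, ?_⟩
    · rw [hsetν]; exact finite_zeros (S ν).dy ha hb hsν
    have hcount := count_stable hF.cY hF.cU (fun μ => (S μ).dy) ha hb (ELν a ⟨ha, le_rfl⟩)
      (ERν b ⟨le_rfl, hb⟩) hsν
    filter_upwards [EL, ER, hcount] with μ e1 e2 e3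
    refine ⟨fun _ => ?_, fun h => absurd h hU⟩
    rw [hsetν, set_eq ha hb e1 e2]
    exact e3.2


/-! ## Global count and conversion to the original problem -/

lemma zero_dv_const {f : ℝ → ℝ} (d : ∀ x ∈ Icc (0:ℝ) 1, HasDerivWithinAt f 0 (Icc 0 1) x) :
    ∀ x ∈ Icc (0:ℝ) 1, f x = f 0 :=
  constant_of_has_deriv_right_zero (fun x hx => (d x hx).continuousWithinAt)
    (fun x hx => to_Ici hx (d x ⟨hx.1, hx.2.le⟩))

lemma rolle_dv {f g : ℝ → ℝ} (d : ∀ x ∈ Icc (0:ℝ) 1, HasDerivWithinAt f (g x) (Icc 0 1) x)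
    {a b : ℝ} (ha : 0 ≤ a) (hab : a < b) (hb : b ≤ 1) (h1 : f a = 0) (h2 : f b = 0) :
    ∃ c, a < c ∧ c < b ∧ g c = 0 := by
  obtain ⟨c, hc, h⟩ := exists_hasDerivAt_eq_zero (f := f) (f' := g) hab
    ((contOn_of_dv d).mono (Icc_subset_Icc ha hb)) (h1.trans h2.symm)
    (fun x hx => hasDerivAt_of_dv d ⟨lt_of_le_of_lt ha hx.1, lt_of_lt_of_le hx.2 hb⟩)
  exact ⟨c, hc.1, hc.2, h⟩

lemma count_zero {q r : ℝ → ℝ} (hC : Coef q r) {Y U W Z : ℝ → ℝ → ℝ} (hF : Fam q r Y U W Z) :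
    {x ∈ Ioo (0:ℝ) 1 | Y 0 x = 0} = ∅ := by
  have S := hF.sys 0
  rw [eq_empty_iff_forall_notMem]
  rintro a ⟨⟨ha0, ha1⟩, ha⟩
  obtain ⟨b1, h1, h2, h3⟩ := rolle_dv S.dy le_rfl ha0 ha1.le (hF.y0 0) ha
  obtain ⟨b2, h4, h5, h6⟩ := rolle_dv S.dy ha0.le ha1 le_rfl ha (hF.y1 0)
  obtain ⟨c1, k1, k2, k3⟩ := rolle_dv S.du le_rfl h1 (by linarith) (hF.u0 0) h3
  obtain ⟨c2, k4, k5, k6⟩ := rolle_dv S.du h1.le (by linarith : b1 < b2) h5.le h3 h6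
  have e1 : W 0 c1 = 0 := by
    have := hC.qp c1 ⟨k1.le, by linarith⟩
    rcases mul_eq_zero.1 k3 with h | h
    · linarith
    · exact h
  have e2 : W 0 c2 = 0 := by
    have := hC.qp c2 ⟨by linarith, by linarith⟩
    rcases mul_eq_zero.1 k6 with h | h
    · linarith
    · exact h
  obtain ⟨e, l1, l2, l3⟩ := rolle_dv S.dw k1.le (by linarith : c1 < c2) (by linarith) e1 e2
  have hz := zero_dv_const (f := Z 0) (fun x hx => by simpa using S.dz x hx)
  have hz0 : Z 0 0 = 0 := by rw [← hz e ⟨by linarith, by linarith⟩]; exact l3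
  have hw := zero_dv_const (f := W 0) (fun x hx => by
    have := S.dw x hx
    rwa [hz x hx, hz0] at this)
  have := hw c1 ⟨by linarith, by linarith⟩
  have := hF.w0 0 le_rfl
  linarith

lemma count_global {q r : ℝ → ℝ} (hC : Coef q r) {Y U W Z : ℝ → ℝ → ℝ} (hF : Fam q r Y U W Z)
    {M : ℝ} (hM : 0 ≤ M) {S : Set ℝ} (hS : S = {μ | U μ 1 = 0 ∧ 0 < μ ∧ μ < M}) (hfin : S.Finite) :
    {x ∈ Ioo (0:ℝ) 1 | Y M x = 0}.ncard = S.ncard := by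
  set N : ℝ → ℕ := fun μ => {x ∈ Ioo (0:ℝ) 1 | Y μ x = 0}.ncard with hN
  set f : ℝ → ℤ := fun μ => (N μ : ℤ) - ({s ∈ S | s < μ}.ncard : ℤ) with hf
  have hcont : ContinuousOn f (Icc 0 M) := by
    intro ν hν
    refine (continuousWithinAt_const (b := f ν)).congr_of_eventuallyEq ?_ rfl
    have hnh : (S \ {ν})ᶜ ∈ 𝓝 ν :=
      (hfin.subset sdiff_subset).isClosed.isOpen_compl.mem_nhds (by simp)
    obtain ⟨ε, hε, hball⟩ := Metric.mem_nhds_iff.1 hnh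
    have hsep : ∀ s ∈ S, s ≠ ν → ε ≤ |s - ν| := by
      intro s hs hne
      by_contra hcon
      push Not at hcon
      exact hball (by simpa [Real.dist_eq] using hcon) ⟨hs, hne⟩
    filter_upwards [mem_nhdsWithin_of_mem_nhds (local_step hC hF hν.1).2,
      mem_nhdsWithin_of_mem_nhds (Metric.ball_mem_nhds ν hε), self_mem_nhdsWithin] with μ h1 h2 h3
    rw [Metric.mem_ball, Real.dist_eq, abs_lt] at h2
    have key : ∀ s ∈ S, s ≠ ν → (s < μ ↔ s < ν) := by
      intro s hs hne
      rcases le_abs'.1 (hsep s hs hne) with h | h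
      · exact ⟨fun _ => by linarith, fun _ => by linarith⟩
      · exact ⟨fun _ => by linarith, fun _ => by linarith⟩
    by_cases hcase : U ν 1 ≠ 0 ∨ μ ≤ ν
    · have e1 : N μ = N ν := h1.1 hcase
      have e2 : {s ∈ S | s < μ} = {s ∈ S | s < ν} := by
        ext s
        refine and_congr_right fun hs => ?_
        by_cases hsν : s = ν
        · subst hsν
          rcases hcase with h | h
          · rw [hS] at hs
            exact absurd hs.1 h
          · exact ⟨fun h' => absurd h' (not_lt.2 h), fun h' => absurd h' (lt_irrefl _)⟩
        · exact key s hs hsν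
      simp only [hf, e1, e2]
    · push Not at hcase
      have e1 : N μ = N ν + 1 := h1.2 hcase.1 hcase.2
      have hνS : ν ∈ S := by
        rw [hS]
        exact ⟨hcase.1, (crossing hC hF hν.1 hcase.1).1, lt_of_lt_of_le hcase.2 h3.2⟩
      have e2 : {s ∈ S | s < μ} = insert ν {s ∈ S | s < ν} := by
        ext s
        by_cases hsν : s = ν
        · subst hsν
          simp [hνS, hcase.2]
        · simp only [mem_insert_iff, hsν, false_or]
          exact and_congr_right fun hs => key s hs hsν
      have e3 : {s ∈ S | s < μ}.ncard = {s ∈ S | s < ν}.ncard + 1 := by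
        rw [e2]
        exact ncard_insert_of_notMem (by simp) (hfin.subset (sep_subset _ _))
      simp only [hf, e1, e3]
      push_cast
      ring
  have hconst := isPreconnected_Icc.constant hcont (left_mem_Icc.2 hM) (right_mem_Icc.2 hM)
  have f0 : f 0 = 0 := by
    have a1 : N 0 = 0 := by simp only [hN, count_zero hC hF, ncard_empty]
    have a2 : {s ∈ S | s < 0} = ∅ := by
      rw [eq_empty_iff_forall_notMem]
      rintro s ⟨hs, h⟩
      rw [hS] at hs
      linarith [hs.2.1]
    simp only [hf, a1, a2, ncard_empty]
    simp
  have fM : {s ∈ S | s < M} = S := by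
    ext s
    refine ⟨fun h => h.1, fun h => ⟨h, ?_⟩⟩
    rw [hS] at h
    exact h.2.2
  rw [f0] at hconst
  simp only [hf, fM] at hconst
  show N M = _
  omega

lemma udI : UniqueDiffOn ℝ (Icc (0:ℝ) 1) := uniqueDiffOn_Icc zero_lt_one

lemma dv_eq {f g : ℝ → ℝ} (d : ∀ x ∈ Icc (0:ℝ) 1, HasDerivWithinAt f (g x) (Icc 0 1) x) :
    ∀ x ∈ Icc (0:ℝ) 1, Dv f x = g x :=
  fun x hx => (d x hx).derivWithin (udI x hx)

lemma dv_congr {f g : ℝ → ℝ} (h : ∀ x ∈ Icc (0:ℝ) 1, f x = g x) :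
    ∀ x ∈ Icc (0:ℝ) 1, Dv f x = Dv g x :=
  fun x hx => derivWithin_congr h (h x hx)

lemma cd2_of {f g h : ℝ → ℝ} (d : ∀ x ∈ Icc (0:ℝ) 1, HasDerivWithinAt f (g x) (Icc 0 1) x)
    (d' : ∀ x ∈ Icc (0:ℝ) 1, HasDerivWithinAt g (h x) (Icc 0 1) x)
    (hh : ContinuousOn h (Icc 0 1)) : ContDiffOn ℝ 2 f (Icc 0 1) := by
  have s1 : ContDiffOn ℝ 1 g (Icc 0 1) := by
    rw [show (1 : WithTop ℕ∞) = 0 + 1 by norm_num, contDiffOn_succ_iff_derivWithin udI]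
    refine ⟨fun x hx => (d' x hx).differentiableWithinAt, by simp, ?_⟩
    rw [contDiffOn_zero]
    exact hh.congr (dv_eq d')
  rw [show (2 : WithTop ℕ∞) = 1 + 1 by norm_num, contDiffOn_succ_iff_derivWithin udI]
  exact ⟨fun x hx => (d x hx).differentiableWithinAt, by simp, s1.congr (dv_eq d)⟩

lemma dv_of_cd {f : ℝ → ℝ} (h : ContDiffOn ℝ 2 f (Icc 0 1)) :
    (∀ x ∈ Icc (0:ℝ) 1, HasDerivWithinAt f (Dv f x) (Icc 0 1) x) ∧
    (∀ x ∈ Icc (0:ℝ) 1, HasDerivWithinAt (Dv f) (Dv (Dv f) x) (Icc 0 1) x) := by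
  have h1 : ContDiffOn ℝ 1 (Dv f) (Icc 0 1) := h.derivWithin udI (by norm_num)
  exact ⟨fun x hx => ((h.differentiableOn (by norm_num)) x hx).hasDerivWithinAt,
    fun x hx => ((h1.differentiableOn (by norm_num)) x hx).hasDerivWithinAt⟩

lemma sys_of_sol {p r : ℝ → ℝ} {c lam : ℝ} {y : ℝ → ℝ} (hp : ∀ x ∈ Icc (0:ℝ) 1, 0 < p x)
    (h : SolT p r c lam y) :
    Sys (fun x => (p x)⁻¹) (fun x => -c * r x) (-lam) y (Dv y) (fun x => p x * Dv (Dv y) x)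
      (Dv (fun x => p x * Dv (Dv y) x)) := by
  obtain ⟨h1, h2, h3⟩ := h
  have key : ∀ x ∈ Icc (0:ℝ) 1, (p x)⁻¹ * (p x * Dv (Dv y) x) = Dv (Dv y) x := by
    intro x hx
    have := (hp x hx).ne'
    field_simp
  refine ⟨(dv_of_cd h1).1, fun x hx => ?_, (dv_of_cd h2).1, fun x hx => ?_⟩
  · rw [key x hx]
    exact (dv_of_cd h1).2 x hx
  · refine ((dv_of_cd h2).2 x hx).congr_deriv ?_
    rw [key x hx]
    linarith [h3 x hx]

lemma sol_of_sys {p r : ℝ → ℝ} {c lam : ℝ} {y u w z : ℝ → ℝ} (hp : ∀ x ∈ Icc (0:ℝ) 1, 0 < p x)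
    (hC : Coef (fun x => (p x)⁻¹) (fun x => -c * r x))
    (S : Sys (fun x => (p x)⁻¹) (fun x => -c * r x) (-lam) y u w z) : SolT p r c lam y := by
  have cq := hC.qc
  have cr := hC.rc
  have cy := contOn_of_dv S.dy
  have cw := contOn_of_dv S.dw
  have e1 : ∀ x ∈ Icc (0:ℝ) 1, Dv (Dv y) x = (p x)⁻¹ * w x := fun x hx =>
    (dv_congr (dv_eq S.dy) x hx).trans (dv_eq S.du x hx)
  have e2 : ∀ x ∈ Icc (0:ℝ) 1, p x * Dv (Dv y) x = w x := by
    intro x hx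
    have := (hp x hx).ne'
    rw [e1 x hx]
    field_simp
  refine ⟨cd2_of S.dy S.du (cq.mul cw), ?_, ?_⟩
  · exact (cd2_of S.dw S.dz (continuousOn_const.mul ((cq.mul cw).add (cr.mul cy)))).congr e2
  · intro x hx
    have e3 := (dv_congr (dv_congr e2) x hx).trans
      ((dv_congr (dv_eq S.dw) x hx).trans (dv_eq S.dz x hx))
    rw [e3, e1 x hx]
    ring

lemma fam_nontriv {q r : ℝ → ℝ} (hC : Coef q r) {Y U W Z : ℝ → ℝ → ℝ} (hF : Fam q r Y U W Z)
    {μ : ℝ} (hμ : 0 ≤ μ) : Nontriv (Y μ) := by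
  by_contra hcon
  have h0 : ∀ x ∈ Icc (0:ℝ) 1, Y μ x = 0 := by
    intro x hx
    by_contra h
    exact hcon ⟨x, hx, h⟩
  have ha : (1/2 : ℝ) ∈ Ioo (0:ℝ) 1 := by constructor <;> norm_num
  have hu := (hF.sys μ).no_double hC hμ (hF.y0 μ) (hF.y1 μ) (hF.w0 μ hμ).ne' ha
    (h0 _ (Ioo_subset_Icc_self ha))
  apply hu
  have h1 : ∀ x ∈ Icc (0:ℝ) 1, Dv (Y μ) x = Dv (fun _ => (0:ℝ)) x := dv_congr h0
  rw [← dv_eq (hF.sys μ).dy _ (Ioo_subset_Icc_self ha), h1 _ (Ioo_subset_Icc_self ha)]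
  exact dv_eq (g := fun _ => 0) (fun x _ => hasDerivWithinAt_const x _ 0) _
    (Ioo_subset_Icc_self ha)

lemma eig_iff {p r : ℝ → ℝ} {c lam : ℝ} (hp : ∀ x ∈ Icc (0:ℝ) 1, 0 < p x)
    (hC : Coef (fun x => (p x)⁻¹) (fun x => -c * r x)) {Y U W Z : ℝ → ℝ → ℝ}
    (hF : Fam (fun x => (p x)⁻¹) (fun x => -c * r x) Y U W Z) (hlam : 0 ≤ -lam) :
    EigT1 p r c lam ↔ U (-lam) 1 = 0 := by
  have m0 : (0:ℝ) ∈ Icc (0:ℝ) 1 := by simp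
  have m1 : (1:ℝ) ∈ Icc (0:ℝ) 1 := by simp
  constructor
  · rintro ⟨y, hs, ⟨x, hx, hne⟩, b1, b2, b3, b4⟩
    obtain ⟨k, hk⟩ := hF.uniq _ hlam _ _ _ _ (sys_of_sol hp hs) b1 b2 b3
    have hk0 : k ≠ 0 := by
      rintro rfl
      apply hne
      rw [(hk x hx).1, zero_mul]
    have := (hk 1 m1).2
    rw [b4] at this
    exact (mul_eq_zero.1 this.symm).resolve_left hk0
  · intro h
    have S := hF.sys (-lam)
    refine ⟨Y (-lam), sol_of_sys hp hC S, fam_nontriv hC hF hlam, hF.y0 _, ?_, hF.y1 _, ?_⟩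
    · rw [dv_eq S.dy 0 m0, hF.u0]
    · rw [dv_eq S.dy 1 m1, h]

theorem stmt_15 (p r : ℝ → ℝ) (c : ℝ) (n : ℕ) (lam : ℝ) (y : ℝ → ℝ)
    (hpc : ContinuousOn p (Icc 0 1)) (hrc : ContinuousOn r (Icc 0 1))
    (hp : ∀ x ∈ Icc (0:ℝ) 1, 0 < p x) (hr : ∀ x ∈ Icc (0:ℝ) 1, 0 < r x)
    (hc : c < 0) (hn : 1 ≤ n) (hlam : lam < 0)
    (heig : EigT1 p r c lam)
    (hfin : {μ : ℝ | EigT1 p r c μ ∧ lam < μ ∧ μ < 0}.Finite)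
    (hcard : {μ : ℝ | EigT1 p r c μ ∧ lam < μ ∧ μ < 0}.ncard = n - 1)
    (hy : SolT p r c lam y) (hnt : Nontriv y) (hbc : BC1 y) :
    {x ∈ Ioo (0:ℝ) 1 | y x = 0}.Finite ∧
      {x ∈ Ioo (0:ℝ) 1 | y x = 0}.ncard = n - 1 ∧
      ∀ a ∈ Ioo (0:ℝ) 1, y a = 0 → Dv y a ≠ 0 := by
  have hC : Coef (fun x => (p x)⁻¹) (fun x => -c * r x) :=
    { qc := hpc.inv₀ (fun x hx => (hp x hx).ne')
      rc := continuousOn_const.mul hrc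
      qp := fun x hx => inv_pos.2 (hp x hx)
      rp := fun x hx => mul_pos (neg_pos.2 hc) (hr x hx) }
  obtain ⟨Y, U, W, Z, hF⟩ := exists_fam hC
  have hM : 0 ≤ -lam := by linarith
  have Sy := sys_of_sol hp hy
  obtain ⟨b1, b2, b3, b4⟩ := hbc
  obtain ⟨k, hk⟩ := hF.uniq _ hM _ _ _ _ Sy b1 b2 b3
  have hk0 : k ≠ 0 := by
    rintro rfl
    obtain ⟨x, hx, hne⟩ := hnt
    apply hne
    rw [(hk x hx).1, zero_mul]
  have hset : {x ∈ Ioo (0:ℝ) 1 | y x = 0} = {x ∈ Ioo (0:ℝ) 1 | Y (-lam) x = 0} := by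
    ext x
    refine and_congr_right fun hx => ?_
    rw [(hk x (Ioo_subset_Icc_self hx)).1]
    simp [hk0]
  have himg : {μ : ℝ | U μ 1 = 0 ∧ 0 < μ ∧ μ < -lam} =
      (fun μ : ℝ => -μ) '' {μ : ℝ | EigT1 p r c μ ∧ lam < μ ∧ μ < 0} := by
    ext μ
    constructor
    · rintro ⟨h1, h2, h3⟩
      refine ⟨-μ, ⟨?_, by linarith, by linarith⟩, by simp⟩
      rw [eig_iff hp hC hF (by linarith), neg_neg]
      exact h1
    · rintro ⟨ν, ⟨h1, h2, h3⟩, rfl⟩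
      exact ⟨(eig_iff hp hC hF (by linarith)).1 h1, by show 0 < -ν; linarith,
        by show -ν < -lam; linarith⟩
  have hcount := count_global hC hF hM rfl (himg ▸ hfin.image _)
  rw [himg, ncard_image_of_injective _ neg_injective, hcard] at hcount
  refine ⟨?_, ?_, ?_⟩
  · rw [hset]
    exact (local_step hC hF hM).1
  · rw [hset]
    exact hcount
  · intro a ha hya
    have hA := hk a (Ioo_subset_Icc_self ha)
    have hYa : Y (-lam) a = 0 := by
      rw [hya] at hA
      exact (mul_eq_zero.1 hA.1.symm).resolve_left hk0
    rw [hA.2]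
    exact mul_ne_zero hk0 ((hF.sys (-lam)).no_double hC hM (hF.y0 _) (hF.y1 _)
      (hF.w0 _ hM).ne' ha hYa)
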